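/- arXiv:1210.3786 — 3 statements merged into one kernel-verified Lean document; each statement's English description precedes it below -/
import Mathlib

section
/- Let p ≥ 1 and let c = (c_1,…,c_p), b = (b_1,…,b_p), β = (β_1,…,β_p) be vectors of positive real numbers with β_1 < β_2 < … < β_p. Then the counting function D(λ) = #{(k_1,…,k_p) ∈ ℕ_{≥0}^p : (c_1 k_1 + b_1)^{β_1} (c_2 k_2 + b_2)^{β_2} ⋯ (c_p k_p + b_p)^{β_p} ≤ λ} satisfies D(λ) ~ c_1^{-1} (∏_{j=2}^p c_j^{-β_j/β_1} ζ(β_j/β_1; b_j/c_j)) λ^{1/β_1} as λ → ∞, where ζ(·;·) denotes the Hurwitz zeta function. -/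
open Filter Asymptotics Real

lemma mdc_iff {c b Y : ℝ} (hc : 0 < c) (hY : b ≤ Y) (k : ℕ) :
    c * (k : ℝ) + b ≤ Y ↔ k ∈ Finset.range (⌊(Y - b) / c⌋₊ + 1) := by
  rw [Finset.mem_range, Nat.lt_succ_iff, Nat.le_floor_iff (div_nonneg (by linarith) hc.le),
    le_div_iff₀ hc]
  constructor <;> intro h <;> nlinarith

lemma mdc_hasSum {c b Y : ℝ} (hc : 0 < c) (hY : b ≤ Y) :
    HasSum (fun k : ℕ => if c * (k : ℝ) + b ≤ Y then (1 : ℝ) else 0)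
      (⌊(Y - b) / c⌋₊ + 1) := by
  have h := hasSum_sum_of_ne_finset_zero
    (f := fun k : ℕ => if c * (k : ℝ) + b ≤ Y then (1 : ℝ) else 0)
    (s := Finset.range (⌊(Y - b) / c⌋₊ + 1)) (L := SummationFilter.unconditional ℕ) (by
      intro k hk
      rw [← mdc_iff hc hY] at hk
      simp only [if_neg hk])
  convert h using 1
  rw [Finset.sum_congr rfl (g := fun _ => (1 : ℝ))]
  · simp
  · intro k hk
    rw [← mdc_iff hc hY] at hk
    rw [if_pos hk]

lemma mdc_zero {c b Y : ℝ} (hc : 0 < c) (hY : Y < b) :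
    (fun k : ℕ => if c * (k : ℝ) + b ≤ Y then (1 : ℝ) else 0) = fun _ => 0 := by
  funext k
  rw [if_neg]
  have : 0 ≤ c * (k : ℝ) := by positivity
  linarith

lemma mdc_summable {c b : ℝ} (Y : ℝ) (hc : 0 < c) :
    Summable (fun k : ℕ => if c * (k : ℝ) + b ≤ Y then (1 : ℝ) else 0) := by
  rcases le_or_gt b Y with h | h
  · exact (mdc_hasSum hc h).summable
  · rw [mdc_zero hc h]; exact summable_zero

noncomputable def mdcG (c b Y : ℝ) : ℝ :=
  ∑' k : ℕ, if c * (k : ℝ) + b ≤ Y then (1 : ℝ) else 0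

lemma mdcG_nonneg (c b Y : ℝ) : 0 ≤ mdcG c b Y :=
  tsum_nonneg fun k => by split_ifs <;> norm_num

lemma mdcG_le {c b Y : ℝ} (hc : 0 < c) (hb : 0 < b) (hY : 0 ≤ Y) :
    mdcG c b Y ≤ (c⁻¹ + b⁻¹) * Y := by
  unfold mdcG
  rcases le_or_gt b Y with h | h
  · rw [(mdc_hasSum hc h).tsum_eq]
    have h1 : (⌊(Y - b) / c⌋₊ : ℝ) ≤ (Y - b) / c :=
      Nat.floor_le (div_nonneg (by linarith) hc.le)
    have h2 : (Y - b) / c ≤ Y / c := by gcongr; linarith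
    have h3 : 1 ≤ Y / b := by rwa [le_div_iff₀ hb, one_mul]
    calc _ ≤ Y / c + Y / b := by linarith
      _ = _ := by ring
  · rw [mdc_zero hc h, tsum_zero]; positivity

lemma mdcG_tendsto {c b : ℝ} (hc : 0 < c) :
    Tendsto (fun Y => mdcG c b Y / Y) atTop (nhds c⁻¹) := by
  have hz : Tendsto (fun Y : ℝ => Y⁻¹) atTop (nhds 0) := tendsto_inv_atTop_zero
  have hl : Tendsto (fun Y : ℝ => c⁻¹ - b / c * Y⁻¹) atTop (nhds c⁻¹) := by
    simpa using (tendsto_const_nhds (x := c⁻¹)).sub (hz.const_mul (b / c))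
  have hu : Tendsto (fun Y : ℝ => c⁻¹ - b / c * Y⁻¹ + Y⁻¹) atTop (nhds c⁻¹) := by
    simpa using hl.add hz
  refine tendsto_of_tendsto_of_tendsto_of_le_of_le' hl hu ?_ ?_
  · filter_upwards [eventually_gt_atTop 0, eventually_ge_atTop b] with Y h0 h
    rw [mdcG, (mdc_hasSum hc h).tsum_eq, le_div_iff₀ h0]
    have := (Nat.lt_floor_add_one ((Y - b) / c)).le
    refine le_trans (le_of_eq ?_) this
    field_simp
  · filter_upwards [eventually_gt_atTop 0, eventually_ge_atTop b] with Y h0 h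
    rw [mdcG, (mdc_hasSum hc h).tsum_eq, div_le_iff₀ h0]
    have h1 : (⌊(Y - b) / c⌋₊ : ℝ) ≤ (Y - b) / c :=
      Nat.floor_le (div_nonneg (by linarith) hc.le)
    refine (add_le_add_left h1 1).trans (le_of_eq ?_)
    field_simp

lemma mdc_pi (n : ℕ) : ∀ (f : Fin n → ℕ → ℝ), (∀ j k, 0 ≤ f j k) → (∀ j, Summable (f j)) →
    HasSum (fun m : Fin n → ℕ => ∏ j, f j (m j)) (∏ j, ∑' k, f j k) := by
  induction n with
  | zero =>
    intro f _ _
    have h := hasSum_unique (fun m : Fin 0 → ℕ => ∏ j, f j (m j))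
    simp only [Finset.univ_eq_empty, Finset.prod_empty] at h ⊢
    exact h
  | succ n IH =>
    intro f h0 hf
    have ih := IH (fun j => f j.succ) (fun j => h0 _) (fun j => hf _)
    have hg0 : (0 : (Fin n → ℕ) → ℝ) ≤ fun m => ∏ j, f j.succ (m j) := by
      intro m
      exact Finset.prod_nonneg fun j _ => h0 j.succ (m j)
    have hf0 : (0 : ℕ → ℝ) ≤ f 0 := fun k => h0 0 k
    have hm := Summable.mul_of_nonneg (hf 0) ih.summable hf0 hg0
    have h := HasSum.mul (hf 0).hasSum ih hm
    rw [Fin.prod_univ_succ, ← (Fin.consEquiv (fun _ : Fin (n + 1) => ℕ)).hasSum_iff]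
    have e : ((fun m : Fin (n + 1) → ℕ => ∏ j, f j (m j)) ∘
        (Fin.consEquiv (fun _ : Fin (n + 1) => ℕ))) =
        fun q : ℕ × (Fin n → ℕ) => f 0 q.1 * ∏ j, f j.succ (q.2 j) := by
      funext q
      simp only [Function.comp, Fin.prod_univ_succ, Fin.consEquiv, Equiv.coe_fn_mk,
        Fin.cons_zero, Fin.cons_succ]
    rw [e]
    exact h

lemma mdc_main (n : ℕ) (c b β : Fin (n + 1) → ℝ)
    (hc : ∀ j, 0 < c j) (hb : ∀ j, 0 < b j) (hβpos : ∀ j, 0 < β j)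
    (hβ : StrictMono β) :
    Tendsto (fun x : ℝ => (Nat.card
        {k : Fin (n + 1) → ℕ | ∏ j, (c j * (k j : ℝ) + b j) ^ (β j) ≤ x} : ℝ) / x ^ (1 / β 0))
      atTop (nhds ((c 0)⁻¹ *
          ∏ j : Fin n, ((c j.succ) ^ (-(β j.succ / β 0)) *
              ∑' k : ℕ, ((k : ℝ) + b j.succ / c j.succ) ^ (-(β j.succ / β 0))))) := by
  set W : (Fin n → ℕ) → ℝ :=
    fun m => ∏ j : Fin n, (c j.succ * (m j : ℝ) + b j.succ) ^ (β j.succ) with hW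
  have hpos : ∀ j (k : ℕ), 0 < c j * (k : ℝ) + b j := fun j k => by
    have := hc j; have := hb j; positivity
  have hWpos : ∀ m, 0 < W m := fun m =>
    Finset.prod_pos fun j _ => rpow_pos_of_pos (hpos _ _) _
  have hWsum : HasSum (fun m => (W m) ^ (-(1 / β 0)))
      (∏ j : Fin n, ((c j.succ) ^ (-(β j.succ / β 0)) *
              ∑' k : ℕ, ((k : ℝ) + b j.succ / c j.succ) ^ (-(β j.succ / β 0)))) := by
    have key := mdc_pi n (fun j k => (c j.succ) ^ (-(β j.succ / β 0)) *
              ((k : ℝ) + b j.succ / c j.succ) ^ (-(β j.succ / β 0)))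
      (fun j k => by have := hc j.succ; have := hb j.succ; positivity)
      (fun j => by
        apply Summable.mul_left
        have h1 : 1 < β j.succ / β 0 := by
          rw [lt_div_iff₀ (hβpos 0), one_mul]
          exact hβ (Fin.succ_pos j)
        have := (Real.summable_one_div_nat_add_rpow (b j.succ / c j.succ) _).2 h1
        refine this.congr fun k => ?_
        have h2 : 0 < (k : ℝ) + b j.succ / c j.succ := by
          have := hc j.succ; have := hb j.succ; positivity
        rw [abs_of_pos h2, rpow_neg h2.le, one_div])
    simp only [tsum_mul_left] at key
    convert key using 1
    funext m
    rw [hW, ← Real.finsetProd_rpow _ _ (fun j _ => (rpow_pos_of_pos (hpos _ _) _).le)]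
    refine Finset.prod_congr rfl fun j _ => ?_
    have := hc j.succ
    have := hb j.succ
    rw [← rpow_mul (hpos _ _).le, ← mul_rpow (hc j.succ).le (by positivity)]
    congr 1
    · field_simp
    · ring
  set Y : ℝ → (Fin n → ℕ) → ℝ := fun x m => (x / W m) ^ (β 0)⁻¹ with hY
  have hYeq : ∀ x, 0 < x → ∀ m, Y x m = x ^ (1 / β 0) * (W m) ^ (-(1 / β 0)) := by
    intro x hx m
    simp only [hY]
    rw [div_rpow hx.le (hWpos m).le, rpow_neg (hWpos m).le, one_div, div_eq_mul_inv]
  have hcard : ∀ x, 0 < x → (Nat.card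
        {k : Fin (n + 1) → ℕ | ∏ j, (c j * (k j : ℝ) + b j) ^ (β j) ≤ x} : ℝ)
        = ∑' m, mdcG (c 0) (b 0) (Y x m) := by
    intro x hx
    have hYnn : ∀ m, 0 ≤ Y x m := fun m => by
      have := hWpos m
      simp only [hY]; positivity
    set A := {k : Fin (n + 1) → ℕ | ∏ j, (c j * (k j : ℝ) + b j) ^ (β j) ≤ x} with hA
    set F : (Fin n → ℕ) × ℕ → ℝ :=
      fun q => if c 0 * (q.2 : ℝ) + b 0 ≤ Y x q.1 then (1 : ℝ) else 0 with hF
    have e1 : (Nat.card A : ℝ) = ∑' k, A.indicator (fun _ => (1 : ℝ)) k := by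
      rw [← tsum_subtype, tsum_const]; simp
    rw [e1, ← ((Equiv.prodComm _ _).trans
      (Fin.consEquiv (fun _ : Fin (n + 1) => ℕ))).tsum_eq]
    have e2 : ∀ q : (Fin n → ℕ) × ℕ, A.indicator (fun _ => (1 : ℝ)) (((Equiv.prodComm _ _).trans
      (Fin.consEquiv (fun _ : Fin (n + 1) => ℕ))) q) = F q := by
      rintro ⟨m, k⟩
      simp only [Set.indicator_apply, hF]
      congr 1
      rw [eq_iff_iff, hA, Set.mem_ofPred_eq, Fin.prod_univ_succ]
      simp only [Equiv.trans_apply, Equiv.prodComm_apply, Prod.swap, Fin.consEquiv,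
        Equiv.coe_fn_mk, Fin.cons_zero, Fin.cons_succ]
      simp only [hY]
      rw [Real.le_rpow_inv_iff_of_pos (hpos _ _).le (div_pos hx (hWpos m)).le (hβpos 0),
        le_div_iff₀ (hWpos m)]
    rw [tsum_congr e2]
    have hFnn : 0 ≤ F := fun q => by simp only [hF]; split_ifs <;> norm_num
    have hin : ∀ m, Summable fun k => F (m, k) := fun m => mdc_summable (Y x m) (hc 0)
    have hS : Summable F := by
      rw [summable_prod_of_nonneg hFnn]
      refine ⟨hin, ?_⟩
      refine Summable.of_nonneg_of_le (fun m => mdcG_nonneg (c 0) (b 0) (Y x m))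
        (fun m => mdcG_le (hc 0) (hb 0) (hYnn m)) ?_
      apply Summable.mul_left
      refine (hWsum.summable.mul_left (x ^ (1 / β 0))).congr fun m => ?_
      rw [hYeq x hx]
    rw [hS.tsum_prod' hin]
    rfl
  have hT := tendsto_tsum_of_dominated_convergence (𝓕 := (atTop : Filter ℝ))
    (f := fun x m => mdcG (c 0) (b 0) (Y x m) / x ^ (1 / β 0))
    (g := fun m => (c 0)⁻¹ * (W m) ^ (-(1 / β 0)))
    (bound := fun m => ((c 0)⁻¹ + (b 0)⁻¹) * (W m) ^ (-(1 / β 0)))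
    (hWsum.summable.mul_left _) ?_ ?_
  · rw [tsum_mul_left, hWsum.tsum_eq] at hT
    refine hT.congr' ?_
    filter_upwards [eventually_gt_atTop 0] with x hx
    rw [hcard x hx, tsum_div_const]
  · intro m
    have hYt : Tendsto (fun x => Y x m) atTop atTop :=
      (tendsto_rpow_atTop (inv_pos.2 (hβpos 0))).comp (tendsto_id.atTop_div_const (hWpos m))
    refine (((mdcG_tendsto (b := b 0) (hc 0)).comp hYt).mul_const
      ((W m) ^ (-(1 / β 0)))).congr' ?_
    filter_upwards [eventually_gt_atTop 0] with x hx
    have h1 : (W m) ^ (-(1 / β 0)) ≠ 0 := (rpow_pos_of_pos (hWpos m) _).ne'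
    have h2 : x ^ (1 / β 0) ≠ 0 := (rpow_pos_of_pos hx _).ne'
    simp only [Function.comp]
    conv_lhs => rw [div_mul_eq_mul_div]
    rw [div_eq_div_iff _ h2]
    · nth_rewrite 3 [hYeq x hx]
      ring
    · rw [hYeq x hx]; exact mul_ne_zero h2 h1
  · filter_upwards [eventually_gt_atTop 0] with x hx m
    have h2 : 0 < x ^ (1 / β 0) := rpow_pos_of_pos hx _
    have hYnn : 0 ≤ Y x m := by
      have := hWpos m
      simp only [hY]; positivity
    rw [Real.norm_of_nonneg (div_nonneg (mdcG_nonneg _ _ _) h2.le), div_le_iff₀ h2]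
    refine (mdcG_le (hc 0) (hb 0) hYnn).trans (le_of_eq ?_)
    rw [hYeq x hx]; ring

theorem multi_divisor_counting_leading_term
    {p : ℕ} (hp : 1 ≤ p) (c b β : Fin p → ℝ)
    (hc : ∀ j, 0 < c j) (hb : ∀ j, 0 < b j) (hβpos : ∀ j, 0 < β j)
    (hβ : StrictMono β) :
    (fun x : ℝ => (Nat.card
        {k : Fin p → ℕ | ∏ j, (c j * (k j : ℝ) + b j) ^ (β j) ≤ x} : ℝ))
      ~[atTop] fun x =>
        ((c ⟨0, hp⟩)⁻¹ *
          ∏ j ∈ Finset.univ.erase (⟨0, hp⟩ : Fin p),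
            (c j) ^ (-(β j / β ⟨0, hp⟩)) *
              ∑' k : ℕ, ((k : ℝ) + b j / c j) ^ (-(β j / β ⟨0, hp⟩)))
          * x ^ (1 / β ⟨0, hp⟩) := by
  obtain ⟨n, rfl⟩ : ∃ n, p = n + 1 := ⟨p - 1, by omega⟩
  have h00 : (⟨0, hp⟩ : Fin (n + 1)) = 0 := rfl
  simp only [h00]
  have hprod : ∀ g : Fin (n + 1) → ℝ,
      ∏ j ∈ Finset.univ.erase (0 : Fin (n + 1)), g j = ∏ j : Fin n, g j.succ := by
    intro g
    have : Finset.univ.erase (0 : Fin (n + 1)) = Finset.univ.map (Fin.succEmb n) := by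
      ext j
      refine Fin.cases ?_ (fun i => ?_) j <;> simp [Fin.succ_ne_zero]
    rw [this, Finset.prod_map]
    rfl
  rw [hprod]
  have hmain := mdc_main n c b β hc hb hβpos hβ
  set L := (c 0)⁻¹ * ∏ j : Fin n, ((c j.succ) ^ (-(β j.succ / β 0)) *
    ∑' k : ℕ, ((k : ℝ) + b j.succ / c j.succ) ^ (-(β j.succ / β 0))) with hL
  have hLpos : 0 < L := by
    refine mul_pos (inv_pos.2 (hc 0)) (Finset.prod_pos fun j _ => ?_)
    refine mul_pos (rpow_pos_of_pos (hc _) _) ?_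
    have hk : ∀ k : ℕ, 0 < (k : ℝ) + b j.succ / c j.succ := fun k => by
      have := hc j.succ; have := hb j.succ; positivity
    have h1 : 1 < β j.succ / β 0 := by
      rw [lt_div_iff₀ (hβpos 0), one_mul]
      exact hβ (Fin.succ_pos j)
    have hs := (Real.summable_one_div_nat_add_rpow (b j.succ / c j.succ) _).2 h1
    have hs' : Summable fun k : ℕ => ((k : ℝ) + b j.succ / c j.succ) ^ (-(β j.succ / β 0)) := by
      refine hs.congr fun k => ?_
      rw [abs_of_pos (hk k), rpow_neg (hk k).le, one_div]
    exact hs'.tsum_pos (fun k => (rpow_pos_of_pos (hk k) _).le) 0 (rpow_pos_of_pos (hk 0) _)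
  refine (isEquivalent_iff_tendsto_one ?_).2 ?_
  · filter_upwards [eventually_gt_atTop 0] with x hx
    exact (mul_pos hLpos (rpow_pos_of_pos hx _)).ne'
  · have := hmain.div_const L
    rw [div_self hLpos.ne'] at this
    refine this.congr fun x => ?_
    simp only [Pi.div_apply]
    rw [div_div, mul_comm L]
end

section
/- Let c_1, c_2, b_1, b_2 be positive real numbers and let β_1, β_2 be real numbers with 0 < β_1 < β_2. Then the counting function D(λ) = #{(k_1,k_2) ∈ ℕ_{≥0}^2 : (c_1 k_1 + b_1)^{β_1} (c_2 k_2 + b_2)^{β_2} ≤ λ} satisfies, as λ → ∞, D(λ) = (ζ(β_2/β_1; b_2/c_2) / (c_1 c_2^{β_2/β_1})) λ^{1/β_1} + (ζ(β_1/β_2; b_1/c_1) / (c_2 c_1^{β_1/β_2})) λ^{1/β_2} + O(λ^{1/(β_1+β_2)}), where ζ(s; a) denotes the analytically continued Hurwitz zeta function (note β_1/β_2 < 1). -/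
open Filter Asymptotics Real

/-- The classical Hurwitz zeta function `ζ(s; a)` for `a > 0`, as a real number: the value at
real `s` of the meromorphic continuation of `∑_{k ≥ 0} (k + a)^{-s}`. It is expressed through
Mathlib's `HurwitzZeta.hurwitzZeta` (which is periodic in the parameter, so the finitely many
terms with `k + Int.fract a < a` must be subtracted off). -/
noncomputable def hurwitzZetaReal (s a : ℝ) : ℝ :=
  (HurwitzZeta.hurwitzZeta (↑(Int.fract a) : UnitAddCircle) (s : ℂ)).re
    - ∑ k ∈ Finset.range ⌊a⌋₊, ((k : ℝ) + Int.fract a) ^ (-s)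

/-- Difference between a term of the Hurwitz series and the corresponding integral. -/
noncomputable def hzTerm (α : ℝ) (n : ℕ) (s : ℂ) : ℂ :=
  (((n : ℝ) + 1 + α : ℝ) : ℂ) ^ (-s) -
    ((((n : ℝ) + 1 + α + 1 : ℝ) : ℂ) ^ (1 - s) - (((n : ℝ) + 1 + α : ℝ) : ℂ) ^ (1 - s)) / (1 - s)

lemma hz_cpow_sub_bound {A u : ℝ} (hA : 0 < A) (hu : u ∈ Set.Icc A (A + 1)) {s : ℂ}
    (hs : 0 < s.re) :
    ‖(u : ℂ) ^ (-s) - (A : ℂ) ^ (-s)‖ ≤ ‖s‖ * A ^ (-s.re - 1) := by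
  have hs0 : s ≠ 0 := by rintro rfl; simp at hs
  have key := norm_image_sub_le_of_norm_deriv_le_segment' (f := fun x : ℝ => (x : ℂ) ^ (-s))
    (a := A) (b := A + 1) (f' := fun x => (-s) * (x : ℂ) ^ (-s - 1)) (C := ‖s‖ * A ^ (-s.re - 1))
    (fun x hx => (hasDerivAt_ofReal_cpow_const (by linarith [hx.1] : x ≠ 0)
        (neg_ne_zero.mpr hs0)).hasDerivWithinAt) (fun x hx => by
      have hx0 : 0 < x := by linarith [hx.1]
      rw [norm_mul, norm_neg, Complex.norm_cpow_eq_rpow_re_of_pos hx0]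
      simp only [Complex.sub_re, Complex.neg_re, Complex.one_re]
      gcongr ?_ * ?_
      exact Real.rpow_le_rpow_of_nonpos hA hx.1 (by linarith)) u hu
  refine key.trans ?_
  have : 0 ≤ ‖s‖ * A ^ (-s.re - 1) := by positivity
  nlinarith [hu.1, hu.2]

lemma hz_term_bound {A : ℝ} (hA : 0 < A) {s : ℂ} (hs : 0 < s.re) (hs1 : s ≠ 1) :
    ‖(A : ℂ) ^ (-s) - (((A + 1 : ℝ) : ℂ) ^ (1 - s) - (A : ℂ) ^ (1 - s)) / (1 - s)‖
      ≤ ‖s‖ * A ^ (-s.re - 1) := by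
  have h1s : (1 - s) ≠ 0 := sub_ne_zero.mpr (Ne.symm hs1)
  have key := norm_image_sub_le_of_norm_deriv_le_segment'
    (f := fun x : ℝ => (x : ℂ) ^ (1 - s) / (1 - s) - x * (A : ℂ) ^ (-s))
    (a := A) (b := A + 1) (f' := fun x => (x : ℂ) ^ (-s) - (A : ℂ) ^ (-s))
    (C := ‖s‖ * A ^ (-s.re - 1))
    (fun x hx => by
      have h1 := (hasDerivAt_ofReal_cpow_const (by linarith [hx.1] : x ≠ 0) h1s).div_const (1 - s)
      have h2 := (Complex.ofRealCLM.hasDerivAt (x := x)).mul_const ((A : ℂ) ^ (-s))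
      have h3 := h1.sub h2
      refine HasDerivAt.hasDerivWithinAt ?_
      refine h3.congr_deriv ?_
      rw [mul_div_cancel_left₀ _ h1s]
      simp) (fun x hx => hz_cpow_sub_bound hA ⟨hx.1, hx.2.le⟩ hs) (A + 1) ⟨by linarith, le_rfl⟩
  have h1 : A + 1 - A = 1 := by ring
  rw [h1, mul_one] at key
  refine le_trans (le_of_eq ?_) key
  rw [← norm_neg]
  congr 1
  push_cast
  ring

lemma hz_summable_bound {α δ : ℝ} (hα : 0 ≤ α) (hδ : 0 < δ) :
    Summable (fun n : ℕ => ((n : ℝ) + 1 + α) ^ (-δ - 1)) := by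
  have h := (Real.summable_nat_rpow (p := -δ - 1)).2 (by linarith)
  have h2 := (summable_nat_add_iff 1).2 h
  refine Summable.of_nonneg_of_le (fun n => by positivity) (fun n => ?_) h2
  push_cast
  exact Real.rpow_le_rpow_of_nonpos (by positivity) (by linarith) (by linarith)

lemma hz_term_le {α : ℝ} (hα : 0 ≤ α) (n : ℕ) {s : ℂ} (hs : 0 < s.re) (hs1 : s ≠ 1) :
    ‖hzTerm α n s‖ ≤ ‖s‖ * ((n : ℝ) + 1 + α) ^ (-s.re - 1) :=
  hz_term_bound (by positivity) hs hs1

lemma hz_summable {α : ℝ} (hα : 0 ≤ α) {s : ℂ} (hs : 0 < s.re) (hs1 : s ≠ 1) :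
    Summable (fun n => hzTerm α n s) :=
  Summable.of_norm_bounded ((hz_summable_bound hα hs).mul_left ‖s‖)
    (fun n => hz_term_le hα n hs hs1)

lemma hz_diff_cpow {A : ℝ} (hA : 0 < A) : Differentiable ℂ (fun s : ℂ => (A : ℂ) ^ (-s)) := by
  have : (A : ℂ) ≠ 0 := by exact_mod_cast hA.ne'
  intro s
  exact (differentiableAt_id.neg).const_cpow (Or.inl this)

lemma hz_diff_cpow' {A : ℝ} (hA : 0 < A) : Differentiable ℂ (fun s : ℂ => (A : ℂ) ^ (1 - s)) := by
  have : (A : ℂ) ≠ 0 := by exact_mod_cast hA.ne'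
  intro s
  exact ((differentiableAt_const 1).sub differentiableAt_id).const_cpow (Or.inl this)

lemma hz_term_diff {α : ℝ} (hα : 0 ≤ α) (n : ℕ) {s : ℂ} (hs1 : s ≠ 1) :
    DifferentiableAt ℂ (hzTerm α n) s := by
  have h1s : (1 - s) ≠ 0 := sub_ne_zero.mpr (Ne.symm hs1)
  unfold hzTerm
  exact (hz_diff_cpow (by positivity) s).sub
    (((hz_diff_cpow' (by positivity) s).sub (hz_diff_cpow' (by positivity) s)).div
      ((differentiableAt_const 1).sub differentiableAt_id) h1s)

lemma hz_tsum_diff {α : ℝ} (hα : 0 ≤ α) {s : ℂ} (hs : 0 < s.re) (hs1 : s ≠ 1) :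
    DifferentiableAt ℂ (fun s => ∑' n, hzTerm α n s) s := by
  set U : Set ℂ := {w | s.re / 2 < w.re} ∩ {w | ‖w‖ < ‖s‖ + 1} ∩ {w | w ≠ 1} with hU
  have hUo : IsOpen U :=
    ((isOpen_lt continuous_const Complex.continuous_re).inter
      (isOpen_lt continuous_norm continuous_const)).inter isOpen_ne
  have hsU : s ∈ U := ⟨⟨by simp only [Set.mem_ofPred_eq]; linarith, by simp⟩, hs1⟩
  have := Complex.differentiableOn_tsum_of_summable_norm (F := hzTerm α) (U := U)
    ((hz_summable_bound hα (half_pos hs)).mul_left (‖s‖ + 1))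
    (fun n w hw => (hz_term_diff hα n hw.2).differentiableWithinAt) hUo
    (fun n w hw => by
      have h1 : s.re / 2 < w.re := hw.1.1
      have h2 : ‖w‖ < ‖s‖ + 1 := hw.1.2
      refine (hz_term_le hα n (by linarith) hw.2).trans ?_
      have h0 : (0:ℝ) ≤ n := by positivity
      have := Real.rpow_le_rpow_of_exponent_le (x := (n : ℝ) + 1 + α) (by linarith)
        (show -w.re - 1 ≤ -(s.re / 2) - 1 by linarith)
      gcongr)
  exact (this s hsU).differentiableAt (hUo.mem_nhds hsU)

/-- the `k = 0` term, with the convention `0` when `α = 0`. -/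
noncomputable def hzZero (α : ℝ) (s : ℂ) : ℂ := if α = 0 then 0 else (α : ℂ) ^ (-s)

lemma hz_sum_telescope (α : ℝ) {s : ℂ} (N : ℕ) :
    ∑ n ∈ Finset.range N, hzTerm α n s =
      ∑ n ∈ Finset.range N, (((n : ℝ) + 1 + α : ℝ) : ℂ) ^ (-s)
        - ((((N : ℝ) + 1 + α : ℝ) : ℂ) ^ (1 - s) - ((1 + α : ℝ) : ℂ) ^ (1 - s)) / (1 - s) := by
  induction N with
  | zero => simp
  | succ N ih =>
    rw [Finset.sum_range_succ, ih, Finset.sum_range_succ]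
    unfold hzTerm
    have : (((N + 1 : ℕ) : ℝ) + 1 + α) = (N : ℝ) + 1 + α + 1 := by push_cast; ring
    rw [this]
    ring

lemma hz_eq_of_one_lt {α : ℝ} (hα : α ∈ Set.Ico (0:ℝ) 1) {s : ℂ} (hs : 1 < s.re) :
    HurwitzZeta.hurwitzZeta (α : UnitAddCircle) s =
      hzZero α s + ((1 + α : ℝ) : ℂ) ^ (1 - s) / (s - 1) + ∑' n, hzTerm α n s := by
  have hs1 : s ≠ 1 := by rintro rfl; simp at hs
  have hs0 : s ≠ 0 := by rintro rfl; norm_num at hs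
  have H := HurwitzZeta.hasSum_hurwitzZeta_of_one_lt_re ⟨hα.1, hα.2.le⟩ hs
  have H1 := (hasSum_nat_add_iff' 1).2 H
  have H2 : Tendsto (fun N => ∑ n ∈ Finset.range N, (((n : ℝ) + 1 + α : ℝ) : ℂ) ^ (-s)) atTop
      (nhds (HurwitzZeta.hurwitzZeta (α : UnitAddCircle) s - hzZero α s)) := by
    have h3 := H1.tendsto_sum_nat
    convert h3 using 2
    · refine Finset.sum_congr rfl fun n _ => ?_
      rw [Complex.cpow_neg, one_div]
      push_cast
      rfl
    · simp only [Finset.range_one, Finset.sum_singleton, Nat.cast_zero, zero_add, hzZero]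
      split_ifs with h
      · simp [h, hs0]
      · rw [Complex.cpow_neg, one_div]
  have H3 := (hz_summable hα.1 (by linarith : 0 < s.re) hs1).hasSum.tendsto_sum_nat
  have H4 : Tendsto (fun N : ℕ => (((N : ℝ) + 1 + α : ℝ) : ℂ) ^ (1 - s)) atTop (nhds 0) := by
    rw [tendsto_zero_iff_norm_tendsto_zero]
    have h5 : Tendsto (fun N : ℕ => ((N : ℝ) + 1 + α)) atTop atTop := by
      simp only [add_assoc]
      exact tendsto_atTop_add_const_right _ _ tendsto_natCast_atTop_atTop
    have h6 := (tendsto_rpow_neg_atTop (y := s.re - 1) (by linarith)).comp h5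
    refine h6.congr fun N => ?_
    have := hα.1
    rw [Complex.norm_cpow_eq_rpow_re_of_pos (by positivity)]
    simp
  have H5 := H2.sub ((H4.sub_const (((1 + α : ℝ) : ℂ) ^ (1 - s))).div_const (1 - s))
  have H6 := tendsto_nhds_unique (H3.congr fun N => hz_sum_telescope α N) H5
  rw [H6]
  have h1s : (1 - s) ≠ 0 := sub_ne_zero.mpr (Ne.symm hs1)
  have h1s' : (s - 1) ≠ 0 := sub_ne_zero.mpr hs1
  have : s - 1 = -(1 - s) := by ring
  rw [this, div_neg]
  ring

lemma hz_eq {α : ℝ} (hα : α ∈ Set.Ico (0:ℝ) 1) {s : ℝ} (hs : 0 < s) (hs1 : s ≠ 1) :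
    HurwitzZeta.hurwitzZeta (α : UnitAddCircle) s =
      hzZero α s + ((1 + α : ℝ) : ℂ) ^ (1 - (s : ℂ)) / (s - 1) + ∑' n, hzTerm α n s := by
  set V1 : Set ℂ := {w | 0 < w.re} ∩ {w | w.re < 1} with hV1
  set V2 : Set ℂ := {w | 0 < w.re} ∩ {w | 0 < w.im} with hV2
  set V3 : Set ℂ := {w | 1 < w.re} with hV3
  have c1 : IsPreconnected V1 :=
    ((convex_halfSpace_re_gt 0).inter (convex_halfSpace_re_lt 1)).isPreconnected
  have c2 : IsPreconnected V2 :=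
    ((convex_halfSpace_re_gt 0).inter (convex_halfSpace_im_gt 0)).isPreconnected
  have c3 : IsPreconnected V3 := (convex_halfSpace_re_gt 1).isPreconnected
  have o1 : IsOpen V1 := (isOpen_lt continuous_const Complex.continuous_re).inter
    (isOpen_lt Complex.continuous_re continuous_const)
  have o2 : IsOpen V2 := (isOpen_lt continuous_const Complex.continuous_re).inter
    (isOpen_lt continuous_const Complex.continuous_im)
  have o3 : IsOpen V3 := isOpen_lt continuous_const Complex.continuous_re
  have c12 : IsPreconnected (V1 ∪ V2) := IsPreconnected.union (⟨1/2, 1⟩ : ℂ)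
    (by simp [hV1]; norm_num) (by simp [hV2]) c1 c2
  have c : IsPreconnected ((V1 ∪ V2) ∪ V3) := IsPreconnected.union (⟨2, 1⟩ : ℂ)
    (by right; simp [hV2]) (by simp [hV3]) c12 c3
  have o : IsOpen ((V1 ∪ V2) ∪ V3) := (o1.union o2).union o3
  have hpos : ∀ w ∈ (V1 ∪ V2) ∪ V3, 0 < w.re := by
    rintro w ((h | h) | h)
    · exact h.1
    · exact h.1
    · exact lt_trans one_pos h
  have hne : ∀ w ∈ (V1 ∪ V2) ∪ V3, w ≠ 1 := by
    rintro w ((h | h) | h) rfl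
    · have := h.2; simp at this
    · have := h.2; simp at this
    · simp [hV3] at h
  have a1 : AnalyticOnNhd ℂ (HurwitzZeta.hurwitzZeta (α : UnitAddCircle)) ((V1 ∪ V2) ∪ V3) :=
    DifferentiableOn.analyticOnNhd (fun w hw =>
      (HurwitzZeta.differentiableAt_hurwitzZeta _ (hne w hw)).differentiableWithinAt) o
  have a2 : AnalyticOnNhd ℂ (fun s : ℂ => hzZero α s + ((1 + α : ℝ) : ℂ) ^ (1 - s) / (s - 1)
      + ∑' n, hzTerm α n s) ((V1 ∪ V2) ∪ V3) := by
    refine DifferentiableOn.analyticOnNhd (fun w hw => DifferentiableAt.differentiableWithinAt ?_) o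
    refine (DifferentiableAt.add ?_ ?_).add (hz_tsum_diff hα.1 (hpos w hw) (hne w hw))
    · unfold hzZero
      split_ifs with h
      · exact differentiableAt_const 0
      · exact hz_diff_cpow (lt_of_le_of_ne hα.1 (Ne.symm h)) w
    · exact (hz_diff_cpow' (by linarith [hα.1]) w).div (differentiableAt_id.sub_const 1)
        (sub_ne_zero.mpr (hne w hw))
  have h2 : (2 : ℂ) ∈ V3 := by simp [hV3]
  have := a1.eqOn_of_preconnected_of_eventuallyEq a2 c (z₀ := 2) (Or.inr h2)
    (by filter_upwards [o3.mem_nhds h2] with w hw using hz_eq_of_one_lt hα hw)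
  refine this ?_
  rcases lt_or_gt_of_ne hs1 with h | h
  · left; left; exact ⟨by simpa using hs, by simpa using h⟩
  · right; simpa [hV3] using h

lemma hz_mvt {A B s : ℝ} (hA : 0 < A) (hAB : A ≤ B) (hs : 0 < s) (hs1 : s ≠ 1) :
    B ^ (-s) * (B - A) ≤ (B ^ (1 - s) - A ^ (1 - s)) / (1 - s) ∧
      (B ^ (1 - s) - A ^ (1 - s)) / (1 - s) ≤ A ^ (-s) * (B - A) := by
  rcases hAB.eq_or_lt with rfl | hlt
  · simp
  have h1s : (1 - s) ≠ 0 := sub_ne_zero.mpr (Ne.symm hs1)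
  have hd : ∀ x : ℝ, 0 < x → HasDerivAt (fun x : ℝ => x ^ (1 - s) / (1 - s)) (x ^ (-s)) x := by
    intro x hx
    refine ((Real.hasDerivAt_rpow_const (p := 1 - s) (Or.inl hx.ne')).div_const (1 - s)).congr_deriv ?_
    rw [mul_div_cancel_left₀ _ h1s]
    congr 1
    ring
  obtain ⟨c, hc, hce⟩ := exists_hasDerivAt_eq_slope (fun x : ℝ => x ^ (1 - s) / (1 - s))
    (fun x => x ^ (-s)) hlt
    (fun x hx => (hd x (lt_of_lt_of_le hA hx.1)).continuousAt.continuousWithinAt)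
    (fun x hx => hd x (lt_trans hA hx.1))
  have hBA : 0 < B - A := by linarith
  rw [eq_div_iff hBA.ne', ← sub_div] at hce
  rw [← hce]
  constructor
  · exact mul_le_mul_of_nonneg_right
      (Real.rpow_le_rpow_of_nonpos (lt_trans hA hc.1) hc.2.le (by linarith)) hBA.le
  · exact mul_le_mul_of_nonneg_right
      (Real.rpow_le_rpow_of_nonpos hA hc.1.le (by linarith)) hBA.le

/-- real version of `hzTerm` -/
noncomputable def hzTermR (α : ℝ) (n : ℕ) (s : ℝ) : ℝ :=
  ((n : ℝ) + 1 + α) ^ (-s) -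
    (((n : ℝ) + 1 + α + 1) ^ (1 - s) - ((n : ℝ) + 1 + α) ^ (1 - s)) / (1 - s)

lemma hzTerm_ofReal {α : ℝ} (hα : 0 ≤ α) (n : ℕ) (s : ℝ) :
    hzTerm α n s = ((hzTermR α n s : ℝ) : ℂ) := by
  unfold hzTerm hzTermR
  rw [Complex.ofReal_sub, Complex.ofReal_div, Complex.ofReal_sub, Complex.ofReal_cpow (by positivity),
    Complex.ofReal_cpow (by positivity), Complex.ofReal_cpow (by positivity)]
  push_cast
  rfl

lemma hzTermR_bounds {α : ℝ} (hα : 0 ≤ α) (n : ℕ) {s : ℝ} (hs : 0 < s) (hs1 : s ≠ 1) :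
    0 ≤ hzTermR α n s ∧
      hzTermR α n s ≤ ((n : ℝ) + 1 + α) ^ (-s) - ((n : ℝ) + 1 + α + 1) ^ (-s) := by
  have := hz_mvt (A := (n : ℝ) + 1 + α) (B := (n : ℝ) + 1 + α + 1) (by positivity) (by linarith)
    hs hs1
  rw [add_sub_cancel_left, mul_one, mul_one] at this
  unfold hzTermR
  constructor <;> linarith [this.1, this.2]

lemma hzTermR_partial {α : ℝ} (hα : 0 ≤ α) (N J : ℕ) {s : ℝ} (hs : 0 < s) (hs1 : s ≠ 1) :
    0 ≤ ∑ j ∈ Finset.range J, hzTermR α (j + N) s ∧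
    ∑ j ∈ Finset.range J, hzTermR α (j + N) s ≤
      ((N : ℝ) + 1 + α) ^ (-s) - ((N : ℝ) + J + 1 + α) ^ (-s) := by
  refine ⟨Finset.sum_nonneg fun j _ => (hzTermR_bounds hα _ hs hs1).1, ?_⟩
  induction J with
  | zero => simp
  | succ J ih =>
    rw [Finset.sum_range_succ]
    have := (hzTermR_bounds hα (J + N) hs hs1).2
    push_cast at this ⊢
    have e1 : (J : ℝ) + N + 1 + α = N + J + 1 + α := by ring
    have e2 : (N : ℝ) + J + 1 + α + 1 = N + (J + 1) + 1 + α := by ring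
    rw [e1, e2] at this
    linarith

lemma hz_partial0 {α : ℝ} (hα : α ∈ Set.Ico (0:ℝ) 1) {s : ℝ} (hs : 0 < s) (hs1 : s ≠ 1) (M : ℕ) :
    |∑ j ∈ Finset.range (M + 1), ((j : ℝ) + α) ^ (-s)
      - (HurwitzZeta.hurwitzZeta (α : UnitAddCircle) s).re
      - ((M : ℝ) + 1 + α) ^ (1 - s) / (1 - s)| ≤ ((M : ℝ) + 1 + α) ^ (-s) := by
  have hsC : 0 < (s : ℂ).re := by simpa using hs
  have hs1C : (s : ℂ) ≠ 1 := by exact_mod_cast hs1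
  have h1s : (1 - s) ≠ 0 := sub_ne_zero.mpr (Ne.symm hs1)
  have hα0 := hα.1
  have hsum : Summable (fun n => hzTermR α n s) := by
    have := hz_summable hα.1 hsC hs1C
    simp only [hzTerm_ofReal hα.1] at this
    exact Complex.summable_ofReal.1 this
  -- tail bound
  have htail : 0 ≤ ∑' j, hzTermR α (j + M) s ∧
      ∑' j, hzTermR α (j + M) s ≤ ((M : ℝ) + 1 + α) ^ (-s) := by
    have hs' := ((summable_nat_add_iff M).2 hsum).hasSum.tendsto_sum_nat
    refine ⟨ge_of_tendsto' hs' fun J => (hzTermR_partial hα.1 M J hs hs1).1,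
      le_of_tendsto' hs' fun J => (hzTermR_partial hα.1 M J hs hs1).2.trans ?_⟩
    have : 0 ≤ ((M : ℝ) + J + 1 + α) ^ (-s) := by positivity
    linarith
  have hsplit := hsum.sum_add_tsum_nat_add M
  -- finite identity
  have hfin : ∑ n ∈ Finset.range M, hzTermR α n s =
      ∑ n ∈ Finset.range M, ((n : ℝ) + 1 + α) ^ (-s)
        - (((M : ℝ) + 1 + α) ^ (1 - s) - (1 + α) ^ (1 - s)) / (1 - s) := by
    clear hsplit htail
    induction M with
    | zero => simp
    | succ N ih =>
      rw [Finset.sum_range_succ, ih, Finset.sum_range_succ]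
      unfold hzTermR
      have : (((N + 1 : ℕ) : ℝ) + 1 + α) = (N : ℝ) + 1 + α + 1 := by push_cast; ring
      rw [this]
      ring
  have hz : (HurwitzZeta.hurwitzZeta (α : UnitAddCircle) s).re =
      α ^ (-s) - (1 + α) ^ (1 - s) / (1 - s) + ∑' n, hzTermR α n s := by
    rw [hz_eq hα hs hs1]
    simp only [hzTerm_ofReal hα.1]
    rw [← Complex.ofReal_tsum, ← Complex.ofReal_one, ← Complex.ofReal_sub, ← Complex.ofReal_sub,
      ← Complex.ofReal_cpow (by positivity), ← Complex.ofReal_div]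
    have h0 : hzZero α s = ((α ^ (-s) : ℝ) : ℂ) := by
      unfold hzZero
      split_ifs with h
      · rw [h, Real.zero_rpow (by linarith)]; simp
      · rw [Complex.ofReal_cpow hα.1]; simp
    rw [h0, ← Complex.ofReal_add, ← Complex.ofReal_add, Complex.ofReal_re]
    have : s - 1 = -(1 - s) := by ring
    rw [this, div_neg]
    ring
  rw [hz, Finset.sum_range_succ']
  have e : ∀ k : ℕ, (((k + 1 : ℕ) : ℝ) + α) = (k : ℝ) + 1 + α := fun k => by push_cast; ring
  simp only [e, Nat.cast_zero, zero_add]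
  rw [abs_le]
  rw [sub_div] at hfin
  constructor <;> linarith [htail.1, htail.2]

lemma hz_partial {a : ℝ} (ha : 0 < a) {s : ℝ} (hs : 0 < s) (hs1 : s ≠ 1) {N : ℕ} (hN : 1 ≤ N) :
    |∑ k ∈ Finset.range N, ((k : ℝ) + a) ^ (-s) - hurwitzZetaReal s a
      - ((N : ℝ) + a) ^ (1 - s) / (1 - s)| ≤ ((N : ℝ) + a) ^ (-s) := by
  have hdec : a = (⌊a⌋₊ : ℝ) + Int.fract a := by
    rw [natCast_floor_eq_intCast_floor ha.le]
    exact (Int.floor_add_fract a).symm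
  obtain ⟨M, hM⟩ : ∃ M, ⌊a⌋₊ + N = M + 1 := ⟨⌊a⌋₊ + N - 1, by omega⟩
  have h := hz_partial0 (α := Int.fract a) ⟨Int.fract_nonneg a, Int.fract_lt_one a⟩ hs hs1 M
  rw [← hM, Finset.sum_range_add] at h
  have e1 : (M : ℝ) + 1 + Int.fract a = N + a := by
    have : ((⌊a⌋₊ + N : ℕ) : ℝ) = ((M + 1 : ℕ) : ℝ) := by rw [hM]
    push_cast at this
    linarith
  have e2 : ∀ k : ℕ, ((⌊a⌋₊ + k : ℕ) : ℝ) + Int.fract a = k + a := by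
    intro k; push_cast; linarith
  simp only [e1, e2] at h
  unfold hurwitzZetaReal
  convert h using 2
  ring

/-- number of `k : ℕ` with `k + a ≤ X` -/
noncomputable def hzN (a X : ℝ) : ℕ := ⌊X - a + 1⌋₊

lemma hzN_lt {a X : ℝ} {k : ℕ} : k < hzN a X ↔ (k : ℝ) + a ≤ X := by
  unfold hzN
  rw [← Nat.add_one_le_iff, Nat.le_floor_iff' (by omega)]
  push_cast
  constructor <;> intro h <;> linarith

lemma hzN_bound {a X : ℝ} (ha : 0 < a) (hX : 0 ≤ X) : |(hzN a X : ℝ) - X| ≤ a + 1 := by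
  unfold hzN
  rw [abs_le]
  have h1 := Nat.lt_floor_add_one (X - a + 1)
  constructor
  · linarith
  · rcases le_or_gt 0 (X - a + 1) with h | h
    · linarith [Nat.floor_le h]
    · rw [Nat.floor_of_nonpos h.le]
      simp
      linarith

lemma hz_partialX {a : ℝ} (ha : 0 < a) {s : ℝ} (hs : 0 < s) (hs1 : s ≠ 1) {X : ℝ} (hX : a ≤ X) :
    |∑ k ∈ Finset.range (hzN a X), ((k : ℝ) + a) ^ (-s) - hurwitzZetaReal s a
      - X ^ (1 - s) / (1 - s)| ≤ 2 * X ^ (-s) := by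
  have hX0 : 0 < X := by linarith
  have hN : 1 ≤ hzN a X := Nat.succ_le_of_lt (hzN_lt.2 (by simpa using hX))
  have h := hz_partial ha hs hs1 hN
  have l1 : X ≤ hzN a X + a := by
    have := Nat.lt_floor_add_one (X - a + 1)
    unfold hzN; linarith
  have l2 : hzN a X + a ≤ X + 1 := by
    have := Nat.floor_le (show 0 ≤ X - a + 1 by linarith)
    unfold hzN; linarith
  have hm := hz_mvt hX0 l1 hs hs1
  have h3 : ((hzN a X : ℝ) + a) ^ (-s) ≤ X ^ (-s) :=
    Real.rpow_le_rpow_of_nonpos hX0 l1 (by linarith)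
  have h4 : 0 ≤ X ^ (-s) := by positivity
  have h5 : 0 ≤ ((hzN a X : ℝ) + a) ^ (-s) := by positivity
  have h6 : X ^ (-s) * (hzN a X + a - X) ≤ X ^ (-s) := by nlinarith
  have h7 : 0 ≤ ((hzN a X : ℝ) + a) ^ (-s) * (hzN a X + a - X) := mul_nonneg h5 (by linarith)
  rw [sub_div] at hm
  rw [abs_le] at h ⊢
  constructor <;> linarith [h.1, h.2, hm.1, hm.2]

lemma hz_card {a₁ a₂ σ S T : ℝ} (ha₁ : 0 < a₁) (ha₂ : 0 < a₂) (hσ : 0 < σ) (hS : 0 < S)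
    (hT : T = S * S ^ σ) :
    Nat.card {k : ℕ × ℕ | ((k.1 : ℝ) + a₁) * ((k.2 : ℝ) + a₂) ^ σ ≤ T} + hzN a₁ S * hzN a₂ S =
      ∑ j ∈ Finset.range (hzN a₂ S), hzN a₁ (T * ((j : ℝ) + a₂) ^ (-σ)) +
      ∑ i ∈ Finset.range (hzN a₁ S), hzN a₂ (T ^ (1 / σ) * ((i : ℝ) + a₁) ^ (-(1 / σ))) := by
  classical
  have hT0 : 0 < T := by rw [hT]; positivity
  set A : Finset (ℕ × ℕ) := ((Finset.range (hzN a₂ S)).sigma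
    (fun j : ℕ => Finset.range (hzN a₁ (T * ((j : ℝ) + a₂) ^ (-σ))))).image
      (fun p : (_ : ℕ) × ℕ => (p.2, p.1)) with hA
  set B : Finset (ℕ × ℕ) := ((Finset.range (hzN a₁ S)).sigma
    (fun i : ℕ => Finset.range (hzN a₂ (T ^ (1 / σ) * ((i : ℝ) + a₁) ^ (-(1 / σ)))))).image
      (fun p : (_ : ℕ) × ℕ => (p.1, p.2)) with hB
  have cA : A.card = ∑ j ∈ Finset.range (hzN a₂ S), hzN a₁ (T * ((j : ℝ) + a₂) ^ (-σ)) := by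
    rw [hA, Finset.card_image_of_injective, Finset.card_sigma]
    · simp
    · rintro ⟨p, q⟩ ⟨p', q'⟩ h
      simp only [Prod.mk.injEq] at h
      obtain ⟨rfl, rfl⟩ := h
      rfl
  have cB : B.card = ∑ i ∈ Finset.range (hzN a₁ S),
      hzN a₂ (T ^ (1 / σ) * ((i : ℝ) + a₁) ^ (-(1 / σ))) := by
    rw [hB, Finset.card_image_of_injective, Finset.card_sigma]
    · simp
    · rintro ⟨p, q⟩ ⟨p', q'⟩ h
      simp only [Prod.mk.injEq] at h
      obtain ⟨rfl, rfl⟩ := h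
      rfl
  have mA : ∀ i j : ℕ, (i, j) ∈ A ↔ (j : ℝ) + a₂ ≤ S ∧
      ((i : ℝ) + a₁) * ((j : ℝ) + a₂) ^ σ ≤ T := by
    intro i j
    have hj : 0 < ((j : ℝ) + a₂) ^ σ := by positivity
    have e : (i, j) ∈ A ↔ j < hzN a₂ S ∧ i < hzN a₁ (T * ((j : ℝ) + a₂) ^ (-σ)) := by
      simp only [hA, Finset.mem_image, Finset.mem_sigma, Finset.mem_range, Prod.mk.injEq]
      constructor
      · rintro ⟨⟨p, q⟩, h, rfl, rfl⟩; exact h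
      · intro h; exact ⟨⟨j, i⟩, h, rfl, rfl⟩
    rw [e, hzN_lt, hzN_lt, Real.rpow_neg (by positivity), le_mul_inv_iff₀ hj]
  have mB : ∀ i j : ℕ, (i, j) ∈ B ↔ (i : ℝ) + a₁ ≤ S ∧
      ((i : ℝ) + a₁) * ((j : ℝ) + a₂) ^ σ ≤ T := by
    intro i j
    have hi : 0 < (i : ℝ) + a₁ := by positivity
    have hj : 0 < (j : ℝ) + a₂ := by positivity
    have e : (i, j) ∈ B ↔ i < hzN a₁ S ∧
        j < hzN a₂ (T ^ (1 / σ) * ((i : ℝ) + a₁) ^ (-(1 / σ))) := by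
      simp only [hB, Finset.mem_image, Finset.mem_sigma, Finset.mem_range, Prod.mk.injEq]
      constructor
      · rintro ⟨⟨p, q⟩, h, rfl, rfl⟩; exact h
      · intro h; exact ⟨⟨i, j⟩, h, rfl, rfl⟩
    rw [e, hzN_lt, hzN_lt, Real.rpow_neg hi.le, ← div_eq_mul_inv, ← Real.div_rpow hT0.le hi.le,
      one_div, Real.le_rpow_inv_iff_of_pos hj.le (by positivity) hσ, le_div_iff₀ hi, mul_comm]
  have hset : {k : ℕ × ℕ | ((k.1 : ℝ) + a₁) * ((k.2 : ℝ) + a₂) ^ σ ≤ T} = ↑(A ∪ B) := by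
    ext ⟨i, j⟩
    have hi : 0 < (i : ℝ) + a₁ := by positivity
    have hj : 0 < (j : ℝ) + a₂ := by positivity
    rw [Finset.mem_coe, Finset.mem_union, mA, mB]
    change ((i : ℝ) + a₁) * ((j : ℝ) + a₂) ^ σ ≤ T ↔ _
    constructor
    · intro h
      by_contra hcon
      have h1 : S < (i : ℝ) + a₁ := by
        by_contra h'; exact hcon (Or.inr ⟨not_lt.1 h', h⟩)
      have h2 : S < (j : ℝ) + a₂ := by
        by_contra h'; exact hcon (Or.inl ⟨not_lt.1 h', h⟩)
      have h3 : S ^ σ < ((j : ℝ) + a₂) ^ σ := Real.rpow_lt_rpow hS.le h2 hσ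
      have h4 : S * S ^ σ < ((i : ℝ) + a₁) * ((j : ℝ) + a₂) ^ σ :=
        mul_lt_mul'' h1 h3 hS.le (by positivity)
      linarith
    · rintro (h | h) <;> exact h.2
  have hint : A ∩ B = Finset.range (hzN a₁ S) ×ˢ Finset.range (hzN a₂ S) := by
    ext ⟨i, j⟩
    rw [Finset.mem_inter, mA, mB, Finset.mem_product, Finset.mem_range, Finset.mem_range,
      hzN_lt, hzN_lt]
    constructor
    · rintro ⟨h1, h2⟩; exact ⟨h2.1, h1.1⟩
    · rintro ⟨h1, h2⟩
      have h : ((i : ℝ) + a₁) * ((j : ℝ) + a₂) ^ σ ≤ T := by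
        rw [hT]
        exact mul_le_mul h1 (Real.rpow_le_rpow (by positivity) h2 hσ.le) (by positivity) hS.le
      exact ⟨⟨h2, h⟩, ⟨h1, h⟩⟩
  have hc := Finset.card_union_add_card_inter A B
  rw [hint, Finset.card_product, Finset.card_range, Finset.card_range, cA, cB] at hc
  rw [← hc, hset]
  simp

lemma hz_sum_floor {a Y s : ℝ} (ha : 0 < a) {b : ℝ} (hb : 0 < b) (hY : 0 ≤ Y) (n : ℕ) :
    |((∑ j ∈ Finset.range n, hzN a (Y * ((j : ℝ) + b) ^ (-s)) : ℕ) : ℝ)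
      - Y * ∑ j ∈ Finset.range n, ((j : ℝ) + b) ^ (-s)| ≤ n * (a + 1) := by
  rw [Nat.cast_sum, Finset.mul_sum, ← Finset.sum_sub_distrib]
  refine (Finset.abs_sum_le_sum_abs _ _).trans ?_
  refine (Finset.sum_le_sum (g := fun _ => a + 1) fun j _ => hzN_bound ha (by positivity)).trans ?_
  simp [mul_add]

lemma hz_main {a₁ a₂ σ S T : ℝ} (ha₁ : 0 < a₁) (ha₂ : 0 < a₂) (hσ : 1 < σ)
    (hS1 : a₁ ≤ S) (hS2 : a₂ ≤ S) (hS : 1 ≤ S) (hT : T = S * S ^ σ) :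
    |(Nat.card {k : ℕ × ℕ | ((k.1 : ℝ) + a₁) * ((k.2 : ℝ) + a₂) ^ σ ≤ T} : ℝ)
      - (hurwitzZetaReal σ a₂ * T + hurwitzZetaReal (1 / σ) a₁ * T ^ (1 / σ))|
      ≤ (4 + 4 * ((a₁ + 2) * (a₂ + 2))) * S := by
  have hS0 : 0 < S := by linarith
  have hσ0 : 0 < σ := by linarith
  have hT0 : 0 < T := by rw [hT]; positivity
  have hc := hz_card ha₁ ha₂ hσ0 hS0 hT
  have hc' := congrArg (Nat.cast : ℕ → ℝ) hc
  rw [Nat.cast_add, Nat.cast_add, Nat.cast_mul] at hc'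
  have f1 := hz_sum_floor (s := σ) ha₁ ha₂ hT0.le (hzN a₂ S)
  have f2 := hz_sum_floor (s := 1 / σ) ha₂ ha₁ (show 0 ≤ T ^ (1 / σ) by positivity) (hzN a₁ S)
  have g1 := hz_partialX ha₂ hσ0 hσ.ne' hS2
  have hτ : 1 / σ < 1 := by rw [div_lt_one hσ0]; exact hσ
  have g2 := hz_partialX ha₁ (s := 1 / σ) (by positivity) hτ.ne hS1
  have n1 := hzN_bound ha₁ hS0.le
  have n2 := hzN_bound ha₂ hS0.le
  have hTτ : T ^ (1 / σ) = S * S ^ (1 / σ) := by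
    rw [hT, Real.mul_rpow hS0.le (by positivity), ← Real.rpow_mul hS0.le,
      mul_one_div_cancel hσ0.ne', Real.rpow_one, mul_comm]
  have p1 : T * S ^ (-σ) = S := by
    rw [hT, mul_assoc, ← Real.rpow_add hS0]; simp
  have p2 : T ^ (1 / σ) * S ^ (-(1 / σ)) = S := by
    rw [hTτ, mul_assoc, ← Real.rpow_add hS0]; simp
  have q1 : T * S ^ (1 - σ) = S ^ 2 := by
    rw [sub_eq_add_neg, Real.rpow_add hS0, Real.rpow_one, mul_left_comm, p1]; ring
  have q2 : T ^ (1 / σ) * S ^ (1 - 1 / σ) = S ^ 2 := by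
    rw [sub_eq_add_neg, Real.rpow_add hS0, Real.rpow_one, mul_left_comm, p2]; ring
  have g1' := mul_le_mul_of_nonneg_left g1 hT0.le
  have g2' := mul_le_mul_of_nonneg_left g2 (show 0 ≤ T ^ (1 / σ) by positivity)
  rw [← abs_of_pos hT0, ← abs_mul, abs_of_pos hT0, mul_sub, mul_sub, mul_div_assoc', q1,
    mul_left_comm, p1] at g1'
  have hTp : 0 < T ^ (1 / σ) := by positivity
  rw [← abs_of_pos hTp, ← abs_mul, abs_of_pos hTp, mul_sub, mul_sub, mul_div_assoc', q2,
    mul_left_comm, p2] at g2'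
  have hcancel : S ^ 2 / (1 - σ) + S ^ 2 / (1 - 1 / σ) = S ^ 2 := by
    have h1 : 1 - σ ≠ 0 := by linarith
    have h2 : σ - 1 ≠ 0 := by linarith
    have e : 1 - 1 / σ = (σ - 1) / σ := by field_simp
    have e' : 1 - σ = -(σ - 1) := by ring
    rw [e, e']
    field_simp
    ring
  rw [abs_le] at n1 n2
  have u1 : (hzN a₁ S : ℝ) ≤ (a₁ + 2) * S := by nlinarith only [n1.2, hS, ha₁]
  have u2 : (hzN a₂ S : ℝ) ≤ (a₂ + 2) * S := by nlinarith only [n2.2, hS, ha₂]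
  have v1 : (hzN a₂ S : ℝ) * (a₁ + 1) ≤ (a₁ + 2) * (a₂ + 2) * S := by
    calc (hzN a₂ S : ℝ) * (a₁ + 1) ≤ ((a₂ + 2) * S) * (a₁ + 2) :=
          mul_le_mul u2 (by linarith) (by linarith) (by positivity)
      _ = (a₁ + 2) * (a₂ + 2) * S := by ring
  have v2 : (hzN a₁ S : ℝ) * (a₂ + 1) ≤ (a₁ + 2) * (a₂ + 2) * S := by
    calc (hzN a₁ S : ℝ) * (a₂ + 1) ≤ ((a₁ + 2) * S) * (a₂ + 2) :=
          mul_le_mul u1 (by linarith) (by linarith) (by positivity)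
      _ = (a₁ + 2) * (a₂ + 2) * S := by ring
  have w : |(hzN a₁ S : ℝ) * hzN a₂ S - S ^ 2| ≤ 2 * ((a₁ + 2) * (a₂ + 2) * S) := by
    have e : (hzN a₁ S : ℝ) * hzN a₂ S - S ^ 2 =
        (hzN a₁ S : ℝ) * (hzN a₂ S - S) + S * (hzN a₁ S - S) := by ring
    rw [e]
    have z1 : |(hzN a₁ S : ℝ) * (hzN a₂ S - S)| ≤ hzN a₁ S * (a₂ + 1) := by
      rw [abs_mul, Nat.abs_cast]
      exact mul_le_mul_of_nonneg_left (abs_le.2 n2) (by positivity)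
    have z2 : |S * ((hzN a₁ S : ℝ) - S)| ≤ S * (a₁ + 1) := by
      rw [abs_mul, abs_of_pos hS0]
      exact mul_le_mul_of_nonneg_left (abs_le.2 n1) hS0.le
    have z3 : S * (a₁ + 1) ≤ (a₁ + 2) * (a₂ + 2) * S := by
      have : a₁ + 1 ≤ (a₁ + 2) * (a₂ + 2) := by nlinarith only [mul_pos ha₁ ha₂, ha₁, ha₂]
      rw [mul_comm S]
      exact mul_le_mul_of_nonneg_right this hS0.le
    linarith only [v2, z1, z2, z3, abs_add_le ((hzN a₁ S : ℝ) * (hzN a₂ S - S)) (S * (hzN a₁ S - S))]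
  rw [abs_le] at f1 f2 g1' g2' w ⊢
  constructor <;> linarith only [hc', hcancel, v1, v2, f1.1, f1.2, f2.1, f2.2, g1'.1, g1'.2, g2'.1, g2'.2, w.1, w.2]

theorem two_factor_divisor_counting_expansion
    (c₁ c₂ b₁ b₂ β₁ β₂ : ℝ)
    (hc₁ : 0 < c₁) (hc₂ : 0 < c₂) (hb₁ : 0 < b₁) (hb₂ : 0 < b₂)
    (hβ₁ : 0 < β₁) (hβ : β₁ < β₂) :
    (fun x : ℝ =>
        (Nat.card {k : ℕ × ℕ |
            (c₁ * (k.1 : ℝ) + b₁) ^ β₁ * (c₂ * (k.2 : ℝ) + b₂) ^ β₂ ≤ x} : ℝ)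
          - ((hurwitzZetaReal (β₂ / β₁) (b₂ / c₂) / (c₁ * c₂ ^ (β₂ / β₁))) * x ^ (1 / β₁)
            + (hurwitzZetaReal (β₁ / β₂) (b₁ / c₁) / (c₂ * c₁ ^ (β₁ / β₂))) * x ^ (1 / β₂)))
      =O[atTop] fun x => x ^ (1 / (β₁ + β₂)) := by
  have hβ₂ : 0 < β₂ := by linarith
  have hβs : 0 < β₁ + β₂ := by linarith
  set a₁ := b₁ / c₁ with ha₁
  set a₂ := b₂ / c₂ with ha₂
  have ha₁0 : 0 < a₁ := by positivity
  have ha₂0 : 0 < a₂ := by positivity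
  set σ := β₂ / β₁ with hσ
  have hσ1 : 1 < σ := by rw [hσ, one_lt_div hβ₁]; exact hβ
  have hσinv : β₁ / β₂ = 1 / σ := by rw [hσ, one_div_div]
  set K := c₁ ^ β₁ * c₂ ^ β₂ with hK
  have hK0 : 0 < K := by positivity
  have htend : Tendsto (fun x : ℝ => (x / K) ^ (1 / (β₁ + β₂))) atTop atTop :=
    (tendsto_rpow_atTop (by positivity)).comp (tendsto_id.atTop_div_const hK0)
  refine IsBigO.of_bound ((4 + 4 * ((a₁ + 2) * (a₂ + 2))) * (1 / K ^ (1 / (β₁ + β₂)))) ?_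
  filter_upwards [htend.eventually_ge_atTop a₁, htend.eventually_ge_atTop a₂,
    htend.eventually_ge_atTop 1, eventually_gt_atTop 0] with x h1 h2 h3 hx
  have hy : 0 < x / K := by positivity
  have hT : (x / K) ^ (1 / β₁) = (x / K) ^ (1 / (β₁ + β₂)) * ((x / K) ^ (1 / (β₁ + β₂))) ^ σ := by
    rw [← Real.rpow_mul hy.le, ← Real.rpow_add hy]
    congr 1
    rw [hσ]
    field_simp
  have hm := hz_main ha₁0 ha₂0 hσ1 h1 h2 h3 hT
  have hTσ : ((x / K) ^ (1 / β₁)) ^ (1 / σ) = x ^ (1 / β₂) / (c₂ * c₁ ^ (1 / σ)) := by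
    rw [← Real.rpow_mul hy.le]
    have : 1 / β₁ * (1 / σ) = 1 / β₂ := by rw [hσ]; field_simp
    rw [this, Real.div_rpow hx.le hK0.le, hK, Real.mul_rpow (by positivity) (by positivity),
      ← Real.rpow_mul hc₁.le, ← Real.rpow_mul hc₂.le, mul_one_div_cancel hβ₂.ne', Real.rpow_one,
      mul_one_div, hσinv, mul_comm c₂]
  have hT1 : (x / K) ^ (1 / β₁) = x ^ (1 / β₁) / (c₁ * c₂ ^ σ) := by
    rw [Real.div_rpow hx.le hK0.le, hK, Real.mul_rpow (by positivity) (by positivity),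
      ← Real.rpow_mul hc₁.le, ← Real.rpow_mul hc₂.le, mul_one_div_cancel hβ₁.ne', Real.rpow_one,
      mul_one_div, ← hσ]
  have hset : {k : ℕ × ℕ | (c₁ * (k.1 : ℝ) + b₁) ^ β₁ * (c₂ * (k.2 : ℝ) + b₂) ^ β₂ ≤ x} =
      {k : ℕ × ℕ | ((k.1 : ℝ) + a₁) * ((k.2 : ℝ) + a₂) ^ σ ≤ (x / K) ^ (1 / β₁)} := by
    ext ⟨i, j⟩
    change (c₁ * (i : ℝ) + b₁) ^ β₁ * (c₂ * (j : ℝ) + b₂) ^ β₂ ≤ x ↔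
      ((i : ℝ) + a₁) * ((j : ℝ) + a₂) ^ σ ≤ (x / K) ^ (1 / β₁)
    have hi : 0 < (i : ℝ) + a₁ := by positivity
    have hj : 0 < (j : ℝ) + a₂ := by positivity
    have e1 : c₁ * (i : ℝ) + b₁ = c₁ * ((i : ℝ) + a₁) := by rw [ha₁]; field_simp
    have e2 : c₂ * (j : ℝ) + b₂ = c₂ * ((j : ℝ) + a₂) := by rw [ha₂]; field_simp
    rw [e1, e2, Real.mul_rpow hc₁.le hi.le, Real.mul_rpow hc₂.le hj.le, one_div,
      Real.le_rpow_inv_iff_of_pos (by positivity) hy.le hβ₁, le_div_iff₀ hK0,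
      Real.mul_rpow hi.le (by positivity), ← Real.rpow_mul hj.le, hσ, div_mul_cancel₀ _ hβ₁.ne', hK]
    have : c₁ ^ β₁ * ((i : ℝ) + a₁) ^ β₁ * (c₂ ^ β₂ * ((j : ℝ) + a₂) ^ β₂) =
      ((i : ℝ) + a₁) ^ β₁ * ((j : ℝ) + a₂) ^ β₂ * (c₁ ^ β₁ * c₂ ^ β₂) := by ring
    rw [this]
  rw [hset, hσinv, Real.norm_eq_abs, Real.norm_eq_abs,
    abs_of_pos (show 0 < x ^ (1 / (β₁ + β₂)) by positivity)]
  rw [hTσ] at hm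
  have hR : (4 + 4 * ((a₁ + 2) * (a₂ + 2))) * (x / K) ^ (1 / (β₁ + β₂)) =
      (4 + 4 * ((a₁ + 2) * (a₂ + 2))) * (1 / K ^ (1 / (β₁ + β₂))) * x ^ (1 / (β₁ + β₂)) := by
    rw [Real.div_rpow hx.le hK0.le]; ring
  rw [hR] at hm
  refine le_trans (le_of_eq ?_) hm
  congr 2
  congr 1
  · rw [hT1]; ring
  · ring
end

section
/- Let β_1 and β_2 be positive integers with β_1 < β_2. Then the counting function N(λ) = #{(k_1,k_2) ∈ ℕ_{≥1}^2 : k_1^{β_1} k_2^{β_2} ≤ λ} satisfies, as λ → ∞, N(λ) = ζ(β_2/β_1) λ^{1/β_1} + ζ(β_1/β_2) λ^{1/β_2} + O(λ^{1/(β_1+β_2)}), where ζ denotes the Riemann zeta function, analytically continued to the complex plane away from z = 1 (note 0 < β_1/β_2 < 1). -/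
open Filter Asymptotics Real

/-- The n-th term of the series for (s-1)ζ(s) - 1. -/
noncomputable def gterm (n : ℕ) (s : ℂ) : ℂ :=
  (s - 1) * (((n : ℝ) + 1 : ℝ) : ℂ) ^ (-s)
    + ((((n : ℝ) + 1 + 1 : ℝ) : ℂ) ^ (1 - s) - (((n : ℝ) + 1 : ℝ) : ℂ) ^ (1 - s))

lemma cpow_diff_bound (N : ℝ) (hN : 0 < N) (s : ℂ) (hs : 0 < s.re) (x : ℝ)
    (hx : x ∈ Set.Icc N (N + 1)) :
    ‖(x : ℂ) ^ (-s) - (N : ℂ) ^ (-s)‖ ≤ ‖s‖ * N ^ (-s.re - 1) := by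
  have hs0 : s ≠ 0 := by rintro rfl; simp at hs
  have hpos : ∀ y ∈ Set.Icc N (N + 1), 0 < y := fun y hy => lt_of_lt_of_le hN hy.1
  have key : ‖(x : ℂ) ^ (-s) - (N : ℂ) ^ (-s)‖ ≤ (‖s‖ * N ^ (-s.re - 1)) * ‖x - N‖ := by
    refine Convex.norm_image_sub_le_of_norm_hasDerivWithin_le
      (f := fun y : ℝ => (y : ℂ) ^ (-s)) (f' := fun y : ℝ => (-s) * (y : ℂ) ^ (-s - 1))
      (s := Set.Icc N (N + 1)) (fun y hy => ?_) (fun y hy => ?_) (convex_Icc _ _) ?_ hx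
    · exact (hasDerivAt_ofReal_cpow_const (hpos y hy).ne' (neg_ne_zero.mpr hs0)).hasDerivWithinAt
    · rw [norm_mul, norm_neg, Complex.norm_cpow_eq_rpow_re_of_pos (hpos y hy)]
      have : (-s - 1).re = -s.re - 1 := by simp
      rw [this]
      exact mul_le_mul_of_nonneg_left
        (Real.rpow_le_rpow_of_nonpos hN hy.1 (by linarith)) (norm_nonneg _)
    · exact ⟨le_rfl, by linarith⟩
  refine key.trans (mul_le_of_le_one_right (by positivity) ?_)
  rw [Real.norm_eq_abs, abs_le]
  constructor <;> linarith [hx.1, hx.2]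

/-- General mean value bound. -/
lemma gterm_bound_aux (N : ℝ) (hN : 0 < N) (s : ℂ) (C : ℝ)
    (hC : ∀ x ∈ Set.Icc N (N + 1), ‖(x : ℂ) ^ (-s) - (N : ℂ) ^ (-s)‖ ≤ C) :
    ‖(s - 1) * (N : ℂ) ^ (-s) + (((N + 1 : ℝ) : ℂ) ^ (1 - s) - (N : ℂ) ^ (1 - s))‖
      ≤ ‖s - 1‖ * C := by
  rcases eq_or_ne s 1 with rfl | h1
  · simp
  have hpos : ∀ y ∈ Set.Icc N (N + 1), 0 < y := fun y hy => lt_of_lt_of_le hN hy.1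
  have h1s : 1 - s ≠ 0 := sub_ne_zero.mpr h1.symm
  have key : ‖(((N + 1 : ℝ) : ℂ) ^ (1 - s) - (1 - s) * (N : ℂ) ^ (-s) * ((N + 1 : ℝ) : ℂ))
      - ((N : ℂ) ^ (1 - s) - (1 - s) * (N : ℂ) ^ (-s) * (N : ℂ))‖
      ≤ (‖s - 1‖ * C) * ‖(N + 1) - N‖ := by
    refine Convex.norm_image_sub_le_of_norm_hasDerivWithin_le
      (f := fun y : ℝ => (y : ℂ) ^ (1 - s) - (1 - s) * (N : ℂ) ^ (-s) * (y : ℂ))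
      (f' := fun y : ℝ => (1 - s) * (y : ℂ) ^ (1 - s - 1) - (1 - s) * (N : ℂ) ^ (-s) * 1)
      (s := Set.Icc N (N + 1)) (fun y hy => ?_) (fun y hy => ?_) (convex_Icc _ _) ?_ ?_
    · refine HasDerivAt.hasDerivWithinAt ?_
      exact (hasDerivAt_ofReal_cpow_const (hpos y hy).ne' h1s).sub
        ((Complex.ofRealCLM.hasDerivAt (x := y)).const_mul _)
    · have e : (1 - s - 1) = -s := by ring
      have e2 : (1 - s) * (y : ℂ) ^ (1 - s - 1) - (1 - s) * (N : ℂ) ^ (-s) * 1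
          = (1 - s) * ((y : ℂ) ^ (-s) - (N : ℂ) ^ (-s)) := by rw [e]; ring
      rw [e2, norm_mul, norm_sub_rev]
      exact mul_le_mul_of_nonneg_left (hC y hy) (norm_nonneg _)
    · exact ⟨le_rfl, by linarith⟩
    · exact ⟨by linarith, le_rfl⟩
  have e3 : ‖(N + 1) - N‖ = 1 := by simp
  rw [e3, mul_one] at key
  convert key using 2
  push_cast
  ring

lemma gterm_bound (n : ℕ) (s : ℂ) (hs : 0 < s.re) :
    ‖gterm n s‖ ≤ ‖s - 1‖ * (‖s‖ * ((n : ℝ) + 1) ^ (-s.re - 1)) :=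
  gterm_bound_aux _ (by positivity) s _
    (fun x hx => cpow_diff_bound _ (by positivity) s hs x hx)

lemma gterm_bound_real (n : ℕ) (s : ℝ) (hs : 0 < s) :
    ‖gterm n s‖ ≤ |s - 1| * (((n : ℝ) + 1) ^ (-s) - ((n : ℝ) + 1 + 1) ^ (-s)) := by
  have h := gterm_bound_aux ((n : ℝ) + 1) (by positivity) s
    (((n : ℝ) + 1) ^ (-s) - ((n : ℝ) + 1 + 1) ^ (-s)) (fun x hx => ?_)
  · have e : ‖(s : ℂ) - 1‖ = |s - 1| := by
      rw [← Complex.ofReal_one, ← Complex.ofReal_sub, Complex.norm_real, Real.norm_eq_abs]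
    rw [e] at h
    exact h
  · have hn : (0 : ℝ) < (n : ℝ) + 1 := by positivity
    have hx0 : 0 < x := lt_of_lt_of_le hn hx.1
    rw [← Complex.ofReal_neg, ← Complex.ofReal_cpow hx0.le, ← Complex.ofReal_cpow hn.le,
      ← Complex.ofReal_sub, Complex.norm_real, Real.norm_eq_abs, abs_sub_comm, abs_of_nonneg]
    · linarith [Real.rpow_le_rpow_of_nonpos hx0 hx.2 (by linarith : -s ≤ 0)]
    · linarith [Real.rpow_le_rpow_of_nonpos hn hx.1 (by linarith : -s ≤ 0)]

lemma gterm_sum (s : ℂ) (K : ℕ) :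
    ∑ n ∈ Finset.range K, gterm n s
      = (s - 1) * ∑ n ∈ Finset.range K, (((n : ℝ) + 1 : ℝ) : ℂ) ^ (-s)
        + ((((K : ℝ) + 1 : ℝ) : ℂ) ^ (1 - s) - 1) := by
  induction K with
  | zero => simp
  | succ k ih =>
    rw [Finset.sum_range_succ, ih, Finset.sum_range_succ, gterm]
    push_cast
    ring

lemma summable_bound {e : ℝ} (he : 0 < e) :
    Summable fun n : ℕ => ((n : ℝ) + 1) ^ (-e - 1) := by
  have := (summable_nat_add_iff 1).mpr (Real.summable_nat_rpow.mpr (by linarith : -e - 1 < -1))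
  simpa using this

lemma gterm_summable (s : ℂ) (hs : 0 < s.re) : Summable fun n => gterm n s := by
  refine Summable.of_norm_bounded ?_ (fun n => gterm_bound n s hs)
  exact ((summable_bound hs).mul_left _).mul_left _

lemma tendsto_nat_add_one : Tendsto (fun K : ℕ => (K : ℝ) + 1) atTop atTop :=
  tendsto_atTop_add_const_right _ _ tendsto_natCast_atTop_atTop

lemma gterm_tsum_of_one_lt (s : ℂ) (hs : 1 < s.re) :
    ∑' n, gterm n s = riemannZeta₁ s - 1 := by
  have hs1 : s ≠ 1 := by rintro rfl; simp at hs
  have hs0 : s ≠ 0 := by rintro rfl; simp at hs; linarith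
  have h1 := (gterm_summable s (by linarith)).hasSum.tendsto_sum_nat
  have hz : riemannZeta₁ s = (s - 1) * riemannZeta s := by
    rw [riemannZeta_eq_inv_sub_mul hs1, mul_inv_cancel_left₀ (sub_ne_zero.mpr hs1)]
  have hsum : Summable fun n : ℕ => (((n : ℝ) + 1 : ℝ) : ℂ) ^ (-s) := by
    refine Summable.of_norm_bounded (g := fun n : ℕ => ((n : ℝ) + 1) ^ (-(s.re - 1) - 1))
      (summable_bound (by linarith)) (fun n => ?_)
    rw [Complex.norm_cpow_eq_rpow_re_of_pos (by positivity)]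
    apply le_of_eq
    congr 1
    simp
  have h2 := hsum.hasSum.tendsto_sum_nat
  have h3 : ∑' n : ℕ, (((n : ℝ) + 1 : ℝ) : ℂ) ^ (-s) = riemannZeta s := by
    rw [zeta_eq_tsum_one_div_nat_add_one_cpow hs]
    congr 1
    ext n
    rw [Complex.cpow_neg]
    push_cast
    simp
  rw [h3] at h2
  have h4 : Tendsto (fun K : ℕ => (((K : ℝ) + 1 : ℝ) : ℂ) ^ (1 - s)) atTop (nhds 0) := by
    rw [tendsto_zero_iff_norm_tendsto_zero]
    have := (tendsto_rpow_neg_atTop (by linarith : 0 < s.re - 1)).comp tendsto_nat_add_one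
    refine this.congr (fun K => ?_)
    rw [Complex.norm_cpow_eq_rpow_re_of_pos (by positivity)]
    simp
  have h5 := (h2.const_mul (s - 1)).add (h4.sub_const 1)
  simp only [← gterm_sum] at h5
  rw [tendsto_nhds_unique h1 h5, hz]
  ring

lemma gterm_differentiable (n : ℕ) : Differentiable ℂ (gterm n) := by
  have h1 : (((n : ℝ) + 1 : ℝ) : ℂ) ≠ 0 := by
    rw [Complex.ofReal_ne_zero]; positivity
  have h2 : (((n : ℝ) + 1 + 1 : ℝ) : ℂ) ≠ 0 := by
    rw [Complex.ofReal_ne_zero]; positivity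
  unfold gterm
  refine Differentiable.add (Differentiable.mul (by fun_prop) ?_) (Differentiable.sub ?_ ?_)
  · exact Differentiable.const_cpow (by fun_prop) (Or.inl h1)
  · exact Differentiable.const_cpow (by fun_prop) (Or.inl h2)
  · exact Differentiable.const_cpow (by fun_prop) (Or.inl h1)

lemma gterm_tsum (s : ℂ) (hs : 0 < s.re) :
    ∑' n, gterm n s = riemannZeta₁ s - 1 := by
  set e : ℝ := min (s.re / 2) 1 with he
  set R : ℝ := ‖s‖ + 3 with hR
  have hepos : 0 < e := by positivity
  set U : Set ℂ := {z | e < z.re} ∩ Metric.ball 0 R with hU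
  have hUo : IsOpen U :=
    (isOpen_lt continuous_const Complex.continuous_re).inter Metric.isOpen_ball
  have hUc : Convex ℝ U := (convex_halfSpace_re_gt e).inter (convex_ball _ _)
  have hsU : s ∈ U := by
    refine ⟨?_, ?_⟩
    · have : e ≤ s.re / 2 := min_le_left _ _
      simp only [Set.mem_ofPred_eq]; linarith
    · simp [hR]
  have h2U : (2 : ℂ) ∈ U := by
    refine ⟨?_, ?_⟩
    · have : e ≤ 1 := min_le_right _ _
      simp only [Set.mem_ofPred_eq, Complex.re_ofNat]; linarith
    · simp [hR]; linarith [norm_nonneg s]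
  have hd : DifferentiableOn ℂ (fun z => ∑' n, gterm n z) U := by
    refine Complex.differentiableOn_tsum_of_summable_norm
      (u := fun n : ℕ => (R + 1) * (R * ((n : ℝ) + 1) ^ (-e - 1)))
      (((summable_bound hepos).mul_left _).mul_left _)
      (fun i => (gterm_differentiable i).differentiableOn) hUo (fun n w hw => ?_)
    have hwr : e < w.re := hw.1
    have hwn : ‖w‖ < R := by simpa using hw.2
    refine (gterm_bound n w (by linarith)).trans ?_
    have a1 : ‖w - 1‖ ≤ R + 1 := (norm_sub_le _ _).trans (by simp; linarith)
    have a2 : ((n : ℝ) + 1) ^ (-w.re - 1) ≤ ((n : ℝ) + 1) ^ (-e - 1) :=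
      Real.rpow_le_rpow_of_exponent_le (by linarith [Nat.cast_nonneg (α := ℝ) n]) (by linarith)
    have hR0 : 0 ≤ R := by positivity
    gcongr
  have ha := hd.analyticOnNhd hUo
  have hb : AnalyticOnNhd ℂ (fun z => riemannZeta₁ z - 1) U :=
    (differentiable_riemannZeta₁.sub_const 1).differentiableOn.analyticOnNhd hUo
  refine ha.eqOn_of_preconnected_of_eventuallyEq hb hUc.isPreconnected h2U ?_ hsU
  have : {z : ℂ | 1 < z.re} ∈ nhds (2 : ℂ) :=
    (isOpen_lt continuous_const Complex.continuous_re).mem_nhds (by simp)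
  filter_upwards [this] with z hz
  exact gterm_tsum_of_one_lt z hz

/-- Partial sums of the zeta series. -/
lemma zeta_partial (s : ℝ) (hs : 0 < s) (hs1 : s ≠ 1) (K : ℕ) :
    |∑ n ∈ Finset.range K, ((n : ℝ) + 1) ^ (-s) - ((K : ℝ) + 1) ^ (1 - s) / (1 - s)
      - (riemannZeta (s : ℂ)).re| ≤ ((K : ℝ) + 1) ^ (-s) := by
  have hsc : (s : ℂ) ≠ 1 := by exact_mod_cast hs1
  have h1s : s - 1 ≠ 0 := sub_ne_zero.mpr hs1
  have h1s' : 1 - s ≠ 0 := sub_ne_zero.mpr hs1.symm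
  set D : ℕ → ℝ := fun K => ∑ n ∈ Finset.range K, ((n : ℝ) + 1) ^ (-s)
    - ((K : ℝ) + 1) ^ (1 - s) / (1 - s) with hD
  have hDs : ∀ K, ∑ n ∈ Finset.range K, gterm n s = (((s - 1) * D K - 1 : ℝ) : ℂ) := by
    intro K
    have : (s - 1) * D K - 1
        = (s - 1) * ∑ n ∈ Finset.range K, ((n : ℝ) + 1) ^ (-s)
          + (((K : ℝ) + 1) ^ (1 - s) - 1) := by
      simp only [hD]; field_simp; ring
    have c : ∀ (n : ℕ) (t : ℝ), (((n : ℝ) + 1 : ℝ) : ℂ) ^ (t : ℂ) = ((((n : ℝ) + 1) ^ t : ℝ) : ℂ) :=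
      fun n t => (Complex.ofReal_cpow (by positivity) t).symm
    have e1 : (1 - (s : ℂ)) = ((1 - s : ℝ) : ℂ) := by push_cast; rfl
    rw [this, gterm_sum, e1, ← Complex.ofReal_neg]
    simp only [c]
    rw [Complex.ofReal_add ((s - 1) * _), Complex.ofReal_mul, Complex.ofReal_sum,
      Complex.ofReal_sub s, Complex.ofReal_sub _ 1]
    simp only [Complex.ofReal_one]
  have hlim : Tendsto D atTop (nhds (riemannZeta (s : ℂ)).re) := by
    have h := (gterm_summable s (by simpa using hs)).hasSum.tendsto_sum_nat
    rw [gterm_tsum s (by simpa using hs)] at h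
    have h' := (Complex.continuous_re.tendsto _).comp h
    have h2 : Tendsto (fun K => (s - 1) * D K - 1) atTop
        (nhds ((riemannZeta₁ (s : ℂ) - 1).re)) := by
      refine h'.congr (fun K => ?_)
      rw [Function.comp_apply, hDs, Complex.ofReal_re]
    have h3 := (h2.add_const 1).const_mul (s - 1)⁻¹
    have e : (s - 1)⁻¹ * ((riemannZeta₁ (s : ℂ) - 1).re + 1) = (riemannZeta (s : ℂ)).re := by
      rw [riemannZeta_eq_inv_sub_mul hsc, ← Complex.ofReal_one, ← Complex.ofReal_sub,
        ← Complex.ofReal_inv, Complex.re_ofReal_mul]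
      simp
    rw [e] at h3
    refine h3.congr (fun K => ?_)
    field_simp
    ring
  have hc : Tendsto (fun K : ℕ => ((K : ℝ) + 1) ^ (-s)) atTop (nhds 0) :=
    (tendsto_rpow_neg_atTop hs).comp tendsto_nat_add_one
  have hdiff : ∀ K : ℕ, |D (K + 1) - D K| ≤ ((K : ℝ) + 1) ^ (-s) - ((K : ℝ) + 1 + 1) ^ (-s) := by
    intro K
    have h := gterm_bound_real K s hs
    have e : gterm K s = (((s - 1) * (D (K + 1) - D K) : ℝ) : ℂ) := by
      have e1 := hDs (K + 1)
      rw [Finset.sum_range_succ, hDs K] at e1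
      have e2 : gterm K s = (((s - 1) * D (K + 1) - 1 : ℝ) : ℂ) - (((s - 1) * D K - 1 : ℝ) : ℂ) := by
        rw [← e1]; ring
      rw [e2, ← Complex.ofReal_sub]
      congr 1
      ring
    rw [e, Complex.norm_real, Real.norm_eq_abs, abs_mul] at h
    exact le_of_mul_le_mul_left h (abs_pos.mpr h1s)
  have hanti : Antitone (fun K : ℕ => D K + ((K : ℝ) + 1) ^ (-s)) := by
    refine antitone_nat_of_succ_le (fun K => ?_)
    have := (abs_le.mp (hdiff K)).2
    push_cast
    linarith
  have hmono : Monotone (fun K : ℕ => D K - ((K : ℝ) + 1) ^ (-s)) := by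
    refine monotone_nat_of_le_succ (fun K => ?_)
    have := (abs_le.mp (hdiff K)).1
    push_cast
    linarith
  have l1 := hanti.le_of_tendsto (by simpa using hlim.add hc) K
  have l2 := hmono.ge_of_tendsto (by simpa using hlim.sub hc) K
  change |D K - _| ≤ _
  rw [abs_le]
  constructor <;> linarith

lemma zeta_floor (s : ℝ) (hs : 0 < s) (hs1 : s ≠ 1) (T : ℝ) (hT : 1 ≤ T) :
    |∑ n ∈ Finset.range ⌊T⌋₊, ((n : ℝ) + 1) ^ (-s) - T ^ (1 - s) / (1 - s)
      - (riemannZeta (s : ℂ)).re| ≤ 2 * T ^ (-s) := by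
  have hT0 : 0 < T := by linarith
  have h1 := zeta_partial s hs hs1 ⌊T⌋₊
  have hfl : T ≤ (⌊T⌋₊ : ℝ) + 1 := (Nat.lt_floor_add_one T).le
  have hfu : (⌊T⌋₊ : ℝ) + 1 ≤ T + 1 := by linarith [Nat.floor_le hT0.le]
  have h2 : ((⌊T⌋₊ : ℝ) + 1) ^ (-s) ≤ T ^ (-s) :=
    Real.rpow_le_rpow_of_nonpos hT0 hfl (by linarith)
  have h1s' : 1 - s ≠ 0 := sub_ne_zero.mpr hs1.symm
  have h3 : ‖((⌊T⌋₊ : ℝ) + 1) ^ (1 - s) / (1 - s) - T ^ (1 - s) / (1 - s)‖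
      ≤ T ^ (-s) * ‖((⌊T⌋₊ : ℝ) + 1) - T‖ := by
    refine Convex.norm_image_sub_le_of_norm_hasDerivWithin_le
      (f := fun y : ℝ => y ^ (1 - s) / (1 - s))
      (f' := fun y : ℝ => ((1 - s) * y ^ (1 - s - 1)) / (1 - s))
      (s := Set.Ici T) (fun y hy => ?_) (fun y hy => ?_) (convex_Ici _) ?_ ?_
    · have hy0 : 0 < y := lt_of_lt_of_le hT0 hy
      exact ((Real.hasDerivAt_rpow_const (Or.inl hy0.ne')).div_const _).hasDerivWithinAt
    · have hy0 : 0 < y := lt_of_lt_of_le hT0 hy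
      rw [mul_div_cancel_left₀ _ h1s', Real.norm_eq_abs, abs_of_nonneg (by positivity)]
      have : 1 - s - 1 = -s := by ring
      rw [this]
      exact Real.rpow_le_rpow_of_nonpos hT0 hy (by linarith)
    · exact Set.self_mem_Ici
    · exact hfl
  have h4 : ‖((⌊T⌋₊ : ℝ) + 1) - T‖ ≤ 1 := by
    rw [Real.norm_eq_abs, abs_le]; constructor <;> linarith
  have h5 := h3.trans (mul_le_of_le_one_right (by positivity) h4)
  rw [Real.norm_eq_abs] at h5
  rw [abs_le] at *
  constructor <;> linarith [h1.1, h1.2, h5.1, h5.2]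

/-- The defining inequality in terms of floors. -/
lemma lt_floor_iff (a b : ℕ) (ha : 0 < a) (x : ℝ) (hx : 0 ≤ x) (m n : ℕ) :
    m < ⌊(x / ((n : ℝ) + 1) ^ b) ^ (1 / (a : ℝ))⌋₊
      ↔ ((m : ℝ) + 1) ^ a * ((n : ℝ) + 1) ^ b ≤ x := by
  have hn : (0 : ℝ) < ((n : ℝ) + 1) ^ b := by positivity
  rw [← Nat.succ_le_iff, Nat.le_floor_iff (by positivity), one_div,
    Real.le_rpow_inv_iff_of_pos (by positivity) (by positivity) (by exact_mod_cast ha),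
    Real.rpow_natCast, le_div_iff₀ hn]
  push_cast
  rfl

lemma half_sum (a b : ℕ) (ha : 0 < a) (hb : 0 < b) (hab : a ≠ b) (x : ℝ) (hx : 1 ≤ x) (T : ℝ)
    (hT : T = x ^ (1 / ((a : ℝ) + (b : ℝ)))) :
    |((∑ n ∈ Finset.range ⌊T⌋₊, ⌊(x / ((n : ℝ) + 1) ^ b) ^ (1 / (a : ℝ))⌋₊ : ℕ) : ℝ)
      - (riemannZeta ((b : ℂ) / (a : ℂ))).re * x ^ (1 / (a : ℝ))
      - T ^ 2 * (a / ((a : ℝ) - b))| ≤ 3 * T := by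
  have hx0 : 0 < x := by linarith
  have ha' : (0 : ℝ) < a := by exact_mod_cast ha
  have hb' : (0 : ℝ) < b := by exact_mod_cast hb
  have hab' : (a : ℝ) - b ≠ 0 := sub_ne_zero.mpr (by exact_mod_cast hab)
  have hT1 : 1 ≤ T := by rw [hT]; exact Real.one_le_rpow hx (by positivity)
  have hT0 : 0 < T := by linarith
  set r : ℝ := (b : ℝ) / a with hr
  have hr0 : 0 < r := by positivity
  have hr1 : r ≠ 1 := by
    rw [hr, Ne, div_eq_one_iff_eq ha'.ne']
    exact_mod_cast hab.symm
  have hxT : x ^ (1 / (a : ℝ)) = T ^ (1 + r) := by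
    rw [hT, ← Real.rpow_mul hx0.le]
    congr 1
    rw [hr]; field_simp
  have hz := zeta_floor r hr0 hr1 T hT1
  have hcast : ((r : ℝ) : ℂ) = (b : ℂ) / (a : ℂ) := by rw [hr]; push_cast; rfl
  rw [hcast] at hz
  have hterm : ∀ n : ℕ, (x / ((n : ℝ) + 1) ^ b) ^ (1 / (a : ℝ))
      = T ^ (1 + r) * ((n : ℝ) + 1) ^ (-r) := by
    intro n
    have hn : (0 : ℝ) < (n : ℝ) + 1 := by positivity
    rw [Real.div_rpow hx0.le (by positivity), hxT, ← Real.rpow_natCast, ← Real.rpow_mul hn.le,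
      Real.rpow_neg hn.le, div_eq_mul_inv, mul_one_div]
  set S : ℝ := ∑ n ∈ Finset.range ⌊T⌋₊, ((n : ℝ) + 1) ^ (-r) with hS
  set F : ℝ := ((∑ n ∈ Finset.range ⌊T⌋₊, ⌊(x / ((n : ℝ) + 1) ^ b) ^ (1 / (a : ℝ))⌋₊ : ℕ) : ℝ)
    with hF
  have hKT : (⌊T⌋₊ : ℝ) ≤ T := Nat.floor_le hT0.le
  have hF1 : F ≤ T ^ (1 + r) * S := by
    rw [hF, hS, Finset.mul_sum]
    push_cast
    refine Finset.sum_le_sum (fun n _ => ?_)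
    rw [← hterm]
    exact Nat.floor_le (by positivity)
  have hF2 : T ^ (1 + r) * S ≤ F + T := by
    have : T ^ (1 + r) * S ≤ F + ⌊T⌋₊ := by
      have e : (⌊T⌋₊ : ℝ) = ∑ n ∈ Finset.range ⌊T⌋₊, (1 : ℝ) := by simp
      rw [e, hF, hS, Finset.mul_sum]
      push_cast
      rw [← Finset.sum_add_distrib]
      refine Finset.sum_le_sum (fun n _ => ?_)
      rw [← hterm]
      exact (Nat.lt_floor_add_one _).le
    linarith
  set Z : ℝ := (riemannZeta ((b : ℂ) / (a : ℂ))).re with hZ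
  have hTp : 0 < T ^ (1 + r) := by positivity
  have hmain : |T ^ (1 + r) * S - T ^ 2 * (a / ((a : ℝ) - b)) - Z * T ^ (1 + r)| ≤ 2 * T := by
    have e1 : T ^ (1 + r) * (T ^ (1 - r) / (1 - r)) = T ^ 2 * (a / ((a : ℝ) - b)) := by
      have : T ^ (1 + r) * T ^ (1 - r) = T ^ 2 := by
        rw [← Real.rpow_add hT0, ← Real.rpow_natCast]; congr 1; push_cast; ring
      rw [← mul_div_assoc, this, hr]
      have : (1 : ℝ) - b / a = (a - b) / a := by field_simp
      rw [this]
      field_simp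
    have e2 : T ^ (1 + r) * T ^ (-r) = T := by
      rw [← Real.rpow_add hT0]; simp
    have e3 : T ^ (1 + r) * S - T ^ 2 * (a / ((a : ℝ) - b)) - Z * T ^ (1 + r)
        = T ^ (1 + r) * (S - T ^ (1 - r) / (1 - r) - Z) := by
      rw [← e1]; ring
    rw [e3, abs_mul, abs_of_pos hTp]
    calc _ ≤ T ^ (1 + r) * (2 * T ^ (-r)) := mul_le_mul_of_nonneg_left hz hTp.le
      _ = 2 * (T ^ (1 + r) * T ^ (-r)) := by ring
      _ = 2 * T := by rw [e2]
  rw [hxT]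
  rw [abs_le] at *
  constructor <;> linarith [hmain.1, hmain.2]

lemma card_identity (a b : ℕ) (ha : 0 < a) (hb : 0 < b) (x : ℝ) (hx : 1 ≤ x) (T : ℝ)
    (hT : T = x ^ (1 / ((a : ℝ) + (b : ℝ)))) :
    Nat.card {k : ℕ × ℕ | ((k.1 : ℝ) + 1) ^ a * ((k.2 : ℝ) + 1) ^ b ≤ x} + ⌊T⌋₊ * ⌊T⌋₊
      = ∑ n ∈ Finset.range ⌊T⌋₊, ⌊(x / ((n : ℝ) + 1) ^ b) ^ (1 / (a : ℝ))⌋₊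
        + ∑ m ∈ Finset.range ⌊T⌋₊, ⌊(x / ((m : ℝ) + 1) ^ a) ^ (1 / (b : ℝ))⌋₊ := by
  have hx0 : 0 ≤ x := by linarith
  have hT0 : 0 ≤ T := by rw [hT]; positivity
  have hTpow : T ^ a * T ^ b = x := by
    rw [← pow_add, hT, ← Real.rpow_natCast, ← Real.rpow_mul hx0]
    have : (0 : ℝ) < (a : ℝ) + b := by positivity
    push_cast
    rw [one_div, inv_mul_cancel₀ this.ne', Real.rpow_one]
  set K := ⌊T⌋₊ with hK
  set f : ℕ → ℕ := fun n => ⌊(x / ((n : ℝ) + 1) ^ b) ^ (1 / (a : ℝ))⌋₊ with hf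
  set g : ℕ → ℕ := fun m => ⌊(x / ((m : ℝ) + 1) ^ a) ^ (1 / (b : ℝ))⌋₊ with hg
  set A : Finset (ℕ × ℕ) := ((Finset.range K).sigma fun n => Finset.range (f n)).image
    (fun p => (p.2, p.1)) with hA
  set B : Finset (ℕ × ℕ) := ((Finset.range K).sigma fun n => Finset.range (g n)).image
    (fun p => (p.1, p.2)) with hB
  have hAc : A.card = ∑ n ∈ Finset.range K, f n := by
    rw [hA, Finset.card_image_of_injective, Finset.card_sigma]
    · simp
    · rintro ⟨p, q⟩ ⟨p', q'⟩ h
      simp only [Prod.mk.injEq] at h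
      obtain ⟨rfl, rfl⟩ := h
      rfl
  have hBc : B.card = ∑ n ∈ Finset.range K, g n := by
    rw [hB, Finset.card_image_of_injective, Finset.card_sigma]
    · simp
    · rintro ⟨p, q⟩ ⟨p', q'⟩ h
      simp only [Prod.mk.injEq] at h
      obtain ⟨rfl, rfl⟩ := h
      rfl
  have hAm : ∀ m n : ℕ, (m, n) ∈ A ↔ n < K ∧ ((m : ℝ) + 1) ^ a * ((n : ℝ) + 1) ^ b ≤ x := by
    intro m n
    rw [← lt_floor_iff a b ha x hx0 m n, hA]
    simp only [Finset.mem_image, Finset.mem_sigma, Finset.mem_range, Prod.mk.injEq]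
    constructor
    · rintro ⟨⟨p, q⟩, ⟨h1, h2⟩, rfl, rfl⟩
      exact ⟨h1, h2⟩
    · rintro ⟨h1, h2⟩
      exact ⟨⟨n, m⟩, ⟨h1, h2⟩, rfl, rfl⟩
  have hBm : ∀ m n : ℕ, (m, n) ∈ B ↔ m < K ∧ ((m : ℝ) + 1) ^ a * ((n : ℝ) + 1) ^ b ≤ x := by
    intro m n
    rw [mul_comm, ← lt_floor_iff b a hb x hx0 n m, hB]
    simp only [Finset.mem_image, Finset.mem_sigma, Finset.mem_range, Prod.mk.injEq]
    constructor
    · rintro ⟨⟨p, q⟩, ⟨h1, h2⟩, rfl, rfl⟩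
      exact ⟨h1, h2⟩
    · rintro ⟨h1, h2⟩
      exact ⟨⟨m, n⟩, ⟨h1, h2⟩, rfl, rfl⟩
  have hlt : ∀ n : ℕ, n < K → (n : ℝ) + 1 ≤ T := by
    intro n hn
    have := (Nat.le_floor_iff hT0).mp (Nat.succ_le_of_lt hn)
    push_cast at this
    exact this
  have hge : ∀ n : ℕ, ¬ n < K → T < (n : ℝ) + 1 := by
    intro n hn
    have : (K : ℝ) ≤ n := by exact_mod_cast not_lt.mp hn
    linarith [Nat.lt_floor_add_one T]
  have hS : {k : ℕ × ℕ | ((k.1 : ℝ) + 1) ^ a * ((k.2 : ℝ) + 1) ^ b ≤ x}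
      = ((A ∪ B : Finset (ℕ × ℕ)) : Set (ℕ × ℕ)) := by
    ext ⟨m, n⟩
    rw [Finset.mem_coe, Finset.mem_union, hAm, hBm]
    constructor
    · intro h
      replace h : ((m : ℝ) + 1) ^ a * ((n : ℝ) + 1) ^ b ≤ x := h
      by_contra hcon
      have h1 : ¬ n < K := fun h' => hcon (Or.inl ⟨h', h⟩)
      have h2 : ¬ m < K := fun h' => hcon (Or.inr ⟨h', h⟩)
      have : T ^ a * T ^ b < ((m : ℝ) + 1) ^ a * ((n : ℝ) + 1) ^ b :=
        mul_lt_mul'' (pow_lt_pow_left₀ (hge m h2) hT0 ha.ne')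
          (pow_lt_pow_left₀ (hge n h1) hT0 hb.ne') (by positivity) (by positivity)
      linarith
    · rintro (⟨_, h⟩ | ⟨_, h⟩) <;> exact h
  have hI : A ∩ B = Finset.range K ×ˢ Finset.range K := by
    ext ⟨m, n⟩
    rw [Finset.mem_inter, hAm, hBm, Finset.mem_product, Finset.mem_range, Finset.mem_range]
    constructor
    · rintro ⟨⟨h1, _⟩, h2, _⟩
      exact ⟨h2, h1⟩
    · rintro ⟨h1, h2⟩
      have : ((m : ℝ) + 1) ^ a * ((n : ℝ) + 1) ^ b ≤ x := by
        rw [← hTpow]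
        exact mul_le_mul (pow_le_pow_left₀ (by positivity) (hlt m h1) _)
          (pow_le_pow_left₀ (by positivity) (hlt n h2) _) (by positivity) (by positivity)
      exact ⟨⟨h2, this⟩, h1, this⟩
  have hu := Finset.card_union_add_card_inter A B
  rw [hI, Finset.card_product, Finset.card_range, hAc, hBc] at hu
  rw [hS, Nat.card_coe_set_eq, Set.ncard_coe_finset]
  exact hu

theorem tensorized_hermite_power_counting
    (β₁ β₂ : ℕ) (hβ₁ : 0 < β₁) (hβ : β₁ < β₂) :
    (fun x : ℝ =>
        (Nat.card {k : ℕ × ℕ |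
            ((k.1 : ℝ) + 1) ^ β₁ * ((k.2 : ℝ) + 1) ^ β₂ ≤ x} : ℝ)
          - ((riemannZeta ((β₂ : ℂ) / (β₁ : ℂ))).re * x ^ (1 / (β₁ : ℝ))
            + (riemannZeta ((β₁ : ℂ) / (β₂ : ℂ))).re * x ^ (1 / (β₂ : ℝ))))
      =O[atTop] fun x => x ^ (1 / ((β₁ : ℝ) + (β₂ : ℝ))) := by
  have hβ₂ : 0 < β₂ := by omega
  refine IsBigO.of_bound 8 ?_
  filter_upwards [eventually_ge_atTop 1] with x hx
  set T : ℝ := x ^ (1 / ((β₁ : ℝ) + (β₂ : ℝ))) with hT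
  have hT1 : 1 ≤ T := by rw [hT]; exact Real.one_le_rpow hx (by positivity)
  have h1 := half_sum β₁ β₂ hβ₁ hβ₂ hβ.ne x hx T hT
  have h2 := half_sum β₂ β₁ hβ₂ hβ₁ hβ.ne' x hx T (by rw [hT, add_comm])
  have hc := card_identity β₁ β₂ hβ₁ hβ₂ x hx T hT
  have hc' := congrArg (fun n : ℕ => (n : ℝ)) hc
  rw [Nat.cast_add, Nat.cast_add, Nat.cast_mul] at hc'
  have hK1 : (⌊T⌋₊ : ℝ) ≤ T := Nat.floor_le (by linarith)
  have hK2 : T ≤ (⌊T⌋₊ : ℝ) + 1 := (Nat.lt_floor_add_one T).le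
  have hK0 : (0 : ℝ) ≤ (⌊T⌋₊ : ℝ) := Nat.cast_nonneg _
  have hq1 : (⌊T⌋₊ : ℝ) * (⌊T⌋₊ : ℝ) ≤ T ^ 2 := by nlinarith
  have hq2 : T ^ 2 ≤ (⌊T⌋₊ : ℝ) * (⌊T⌋₊ : ℝ) + 2 * T := by nlinarith
  have hd : (β₁ : ℝ) - β₂ ≠ 0 := sub_ne_zero.mpr (by exact_mod_cast hβ.ne)
  have hd' : (β₂ : ℝ) - β₁ ≠ 0 := sub_ne_zero.mpr (by exact_mod_cast hβ.ne')
  have hfrac : T ^ 2 * (β₁ / ((β₁ : ℝ) - β₂)) + T ^ 2 * (β₂ / ((β₂ : ℝ) - β₁)) = T ^ 2 := by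
    have : (β₂ : ℝ) / ((β₂ : ℝ) - β₁) = - (β₂ / ((β₁ : ℝ) - β₂)) := by
      rw [← neg_sub, div_neg]
    rw [this]
    field_simp
    ring
  rw [Real.norm_eq_abs, Real.norm_eq_abs, abs_of_nonneg (by linarith : (0 : ℝ) ≤ T)]
  rw [abs_le] at *
  constructor <;> linarith [h1.1, h1.2, h2.1, h2.2]
end
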